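/- arXiv:1810.03062 — 2 statements merged into one kernel-verified Lean document; each statement's English description precedes it below -/
import Mathlib

section
/- Let Γ be a virtually infinite cyclic group, i.e. a group with a finite index subgroup isomorphic to ℤ. Then every Borel action of Γ on a standard Borel space X is hyperfinite: there is a Borel action of ℤ on X whose orbit equivalence relation coincides with the orbit equivalence relation of the Γ-action. -/
theorem vc_group {Γ : Type*} [Group Γ]
    (hvc : ∃ H : Subgroup Γ, H.FiniteIndex ∧ Nonempty (H ≃* Multiplicative ℤ)) :
    ∃ h : Γ, (Subgroup.zpowers h).Normal ∧ (Subgroup.zpowers h).FiniteIndex ∧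
      Function.Injective (fun n : ℤ => h ^ n) := by
  obtain ⟨H, hH, ⟨φ⟩⟩ := hvc
  have hcyc : IsCyclic H := isCyclic_of_surjective φ.symm φ.symm.surjective
  have hc2 : IsCyclic (H.normalCore.subgroupOf H) := inferInstance
  obtain ⟨k, hk⟩ := hc2.exists_generator
  have hz : Subgroup.zpowers (k : H).1 = H.normalCore := by
    ext x
    constructor
    · rintro ⟨n, rfl⟩
      exact H.normalCore.zpow_mem k.2 n
    · intro hx
      obtain ⟨n, hn⟩ := hk ⟨⟨x, H.normalCore_le hx⟩, hx⟩
      refine ⟨n, ?_⟩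
      have := congrArg (fun z : H.normalCore.subgroupOf H => ((z : H) : Γ)) hn
      simpa using this
  refine ⟨(k : H).1, ?_, ?_, ?_⟩
  · rw [hz]; infer_instance
  · rw [hz]; infer_instance
  · rw [injective_zpow_iff_not_isOfFinOrder]
    intro hfin
    have h1 : Finite (Subgroup.zpowers (k : H).1) := by
      exact (finite_zpowers.2 hfin).to_subtype
    rw [hz] at h1
    have h2 : Finite Γ := by
      have : Finite (Γ ⧸ H.normalCore) := inferInstance
      exact Finite.of_equiv _ (Subgroup.groupEquivQuotientProdSubgroup (s := H.normalCore)).symm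
    have h3 : Finite (Multiplicative ℤ) := Finite.of_equiv H φ.toEquiv
    exact Infinite.not_finite h3

theorem vc_height {Γ : Type*} [Group Γ]
    (hvc : ∃ H : Subgroup Γ, H.FiniteIndex ∧ Nonempty (H ≃* Multiplicative ℤ)) :
    ∃ w e : Γ → ℤ, (∀ g, e g = 1 ∨ e g = -1) ∧ (∀ d g, w (d * g) = w g + e g * w d) ∧
      ∀ R : ℤ, {g : Γ | |w g| ≤ R}.Finite := by
  classical
  obtain ⟨h, hn, hf, hinj⟩ := vc_group hvc
  have hconj : ∀ g : Γ, ∃ a : ℤ, h ^ a = g * h * g⁻¹ := fun g =>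
    hn.conj_mem h (Subgroup.mem_zpowers h) g
  choose e he using hconj
  have hez : ∀ g (n : ℤ), g * h ^ n = h ^ (e g * n) * g := by
    intro g n
    rw [zpow_mul, he, conj_zpow]; group
  have hinj' : ∀ m n : ℤ, h ^ m = h ^ n → m = n := fun m n hmn => hinj hmn
  have hemul : ∀ a b, e (a * b) = e a * e b := by
    intro a b
    apply hinj'
    have := hez a (e b)
    rw [he b] at this
    rw [he, show a * b * h * (a*b)⁻¹ = (a * (b * h * b⁻¹)) * a⁻¹ by group, this]; group
  have he1 : e 1 = 1 := by
    apply hinj'; rw [he]; simp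
  have heu : ∀ g, e g = 1 ∨ e g = -1 := by
    intro g
    apply Int.eq_one_or_neg_one_of_mul_eq_one (v := e g⁻¹)
    rw [← hemul]; simpa using he1
  -- equivariant function
  let N := Subgroup.zpowers h
  have hrep : ∀ g : Γ, ∃ a : ℤ, g = h ^ a * (QuotientGroup.mk g : Γ ⧸ N).out := by
    intro g
    have : (QuotientGroup.mk g : Γ ⧸ N).out⁻¹ * g ∈ N := by
      rw [← QuotientGroup.eq]; simp
    have h2 := hn.conj_mem _ this ((QuotientGroup.mk g : Γ ⧸ N).out)
    obtain ⟨a, ha⟩ := h2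
    refine ⟨a, ?_⟩
    simp only at ha
    rw [ha]; group
  choose f hf' using hrep
  have hmk : ∀ (m : ℤ) (g : Γ), (QuotientGroup.mk (h ^ m * g) : Γ ⧸ N) = QuotientGroup.mk g := by
    intro m g
    rw [QuotientGroup.eq]
    have := hn.conj_mem (h ^ (-m)) ⟨-m, rfl⟩ g⁻¹
    simpa [mul_assoc] using this
  have hfm : ∀ (m : ℤ) (g : Γ), f (h ^ m * g) = f g + m := by
    intro m g
    apply hinj'
    have h1 := hf' (h ^ m * g)
    rw [hmk] at h1
    have h2 := hf' g
    have h3 : h ^ f (h ^ m * g) * (QuotientGroup.mk g : Γ ⧸ N).out =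
      h ^ m * (h ^ f g * (QuotientGroup.mk g : Γ ⧸ N).out) := by rw [← h1, ← h2]
    rw [← mul_assoc, ← zpow_add] at h3
    rw [mul_right_cancel h3, add_comm]
  let u : Γ → Γ → ℤ := fun c g => f (c * g) - e c * f g
  have hu : ∀ c g g', (QuotientGroup.mk g : Γ ⧸ N) = QuotientGroup.mk g' → u c g = u c g' := by
    intro c g g' hg
    have h1 := hf' g
    have h2 := hf' g'
    rw [← hg] at h2
    have h3 : g = h ^ (f g - f g') * g' := by
      rw [zpow_sub]
      have h4 : (QuotientGroup.mk g : Γ ⧸ N).out = (h ^ f g')⁻¹ * g' := by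
        rw [eq_inv_mul_iff_mul_eq]; exact h2.symm
      rw [mul_assoc, ← h4]; exact h1
    have key : ∀ (m : ℤ), u c (h ^ m * g') = u c g' := by
      intro m
      simp only [u]
      rw [← mul_assoc, hez, mul_assoc, hfm, hfm]; ring
    rw [h3]; exact key _
  have : Fintype (Γ ⧸ N) := Fintype.ofFinite _
  let b : Γ → ℤ := fun c => ∑ q : Γ ⧸ N, u c q.out
  have hshift : ∀ c d, ∑ q : Γ ⧸ N, u c (d * q.out) = b c := by
    intro c d
    refine Eq.trans ?_ (Equiv.sum_comp (Equiv.mulLeft (QuotientGroup.mk d : Γ ⧸ N)) (fun q => u c q.out))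
    refine Finset.sum_congr rfl fun q _ => hu _ _ _ ?_
    simp
  have hb : ∀ c d, b (c * d) = b c + e c * b d := by
    intro c d
    rw [← hshift c d]
    simp only [b, Finset.mul_sum]
    rw [← Finset.sum_add_distrib]
    refine Finset.sum_congr rfl fun q _ => ?_
    simp only [u, hemul, mul_assoc]; ring
  have hbh : ∀ (m : ℤ) , b (h ^ m) = m * Fintype.card (Γ ⧸ N) := by
    intro m
    have : e (h ^ m) = 1 := by
      apply hinj'; rw [he]; group
    simp [b, u, hfm, this, Finset.sum_add_distrib, mul_comm]
  have hbhm : ∀ (m : ℤ) g, b (h ^ m * g) = m * Fintype.card (Γ ⧸ N) + b g := by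
    intro m g
    have : e (h ^ m) = 1 := by
      apply hinj'; rw [he]; group
    rw [hb, hbh, this]; ring
  refine ⟨fun g => b g⁻¹, fun g => e g⁻¹, fun g => heu _, fun d g => ?_, fun R => ?_⟩
  · simp only [mul_inv_rev, hb]
  · have hB : {g : Γ | |b g| ≤ R}.Finite := by
      have hsub : {g : Γ | |b g| ≤ R} ⊆ ⋃ q : Γ ⧸ N,
          (fun m : ℤ => h ^ m * q.out) '' (Set.Icc (-R - |b q.out|) (R + |b q.out|)) := by
        intro g hg
        simp only [Set.mem_iUnion]
        refine ⟨QuotientGroup.mk g, f g, ?_, (hf' g).symm⟩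
        have h1 := hbhm (f g) (QuotientGroup.mk g : Γ ⧸ N).out
        rw [← hf'] at h1
        have hk : (1 : ℤ) ≤ Fintype.card (Γ ⧸ N) := by
          exact_mod_cast Fintype.card_pos
        simp only [Set.mem_ofPred_eq] at hg
        set z := b (QuotientGroup.mk g : Γ ⧸ N).out
        have h2 : |f g * Fintype.card (Γ ⧸ N)| ≤ R + |z| := by
          have : f g * Fintype.card (Γ ⧸ N) = b g - z := by linarith
          rw [this]
          exact (abs_sub _ _).trans (by linarith)
        rw [abs_mul, abs_of_nonneg (by linarith : (0:ℤ) ≤ Fintype.card (Γ ⧸ N))] at h2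
        have h3 : |f g| ≤ R + |z| := by nlinarith [abs_nonneg (f g)]
        have := abs_le.1 h3
        constructor <;> linarith [this.1, this.2]
      refine Set.Finite.subset ?_ hsub
      exact Set.finite_iUnion fun q => (Set.finite_Icc _ _).image _
    have := hB.preimage (f := fun g : Γ => g⁻¹) (inv_injective.injOn)
    exact this

/-- Partial successor graph generating the orbit relation on `W`. -/
def VCGood (Γ : Type*) {X : Type*} [Group Γ] [MeasurableSpace X] [MulAction Γ X]
    (W : Set X) : Prop :=
  ∃ G : X → X → Prop, (∀ g : Γ, MeasurableSet {x | G x (g • x)}) ∧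
    (∀ x y, G x y → ∃ g : Γ, g • x = y) ∧
    (∀ x ∈ W, ∃ y, G x y ∧ ∀ z, G x z → z = y) ∧
    (∀ y ∈ W, ∃ x, G x y ∧ ∀ z, G z y → z = x) ∧
    ∀ x ∈ W, ∀ g : Γ, Relation.EqvGen G x (g • x)

theorem vc_final {Γ X : Type*} [Group Γ] [Countable Γ] [MeasurableSpace X] [MulAction Γ X]
    [MeasurableConstSMul Γ X] (h : VCGood Γ (Set.univ : Set X)) :
    ∃ T : X ≃ X, Measurable (⇑T) ∧ Measurable (⇑T.symm) ∧
      ∀ x y : X, (∃ g : Γ, g • x = y) ↔ (∃ n : ℤ, (T ^ n) x = y) := by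
  obtain ⟨G, hm, hE, hs, hp, hg⟩ := h
  choose t ht ht' using fun x => hs x (Set.mem_univ x)
  choose p hp hp' using fun x => hp x (Set.mem_univ x)
  let T : X ≃ X := ⟨t, p, fun x => (hp' _ _ (ht x)).symm, fun x => (ht' _ _ (hp x)).symm⟩
  have hT : ∀ x y, G x y ↔ T x = y := fun x y =>
    ⟨fun h => (ht' _ _ h).symm, fun h => by rw [← h]; exact ht x⟩
  refine ⟨T, ?_, ?_, fun x y => ⟨?_, ?_⟩⟩
  · intro s hs
    have : T ⁻¹' s = ⋃ g : Γ, {x | G x (g • x)} ∩ (fun x => g • x) ⁻¹' s := by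
      ext x
      simp only [Set.mem_preimage, Set.mem_iUnion, Set.mem_inter_iff, Set.mem_ofPred_eq]
      constructor
      · intro hx
        obtain ⟨g, hgx⟩ := hE x (T x) (ht x)
        exact ⟨g, by rw [hgx]; exact ht x, by rw [hgx]; exact hx⟩
      · rintro ⟨g, h1, h2⟩
        rw [(hT _ _).1 h1]; exact h2
    rw [this]
    exact MeasurableSet.iUnion fun g => (hm g).inter (measurable_const_smul g hs)
  · intro s hs
    have : T.symm ⁻¹' s = ⋃ g : Γ,
        (fun x => g • x) ⁻¹' ({x | G x (g⁻¹ • x)}) ∩ (fun x => g • x) ⁻¹' s := by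
      ext x
      simp only [Set.mem_preimage, Set.mem_iUnion, Set.mem_inter_iff, Set.mem_ofPred_eq,
        inv_smul_smul]
      constructor
      · intro hx
        obtain ⟨g, hgx⟩ := hE (T.symm x) x (hp x)
        refine ⟨g⁻¹, ?_⟩
        have : g⁻¹ • x = T.symm x := by rw [inv_smul_eq_iff]; exact hgx.symm
        rw [this]
        exact ⟨hp x, hx⟩
      · rintro ⟨g, h1, h2⟩
        rw [hT] at h1
        rw [← h1, Equiv.symm_apply_apply]; exact h2
    rw [this]
    exact MeasurableSet.iUnion fun g => (measurable_const_smul g (hm _)).inter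
      (measurable_const_smul g hs)
  · rintro ⟨g, rfl⟩
    have key : ∀ a b, Relation.EqvGen G a b → ∃ n : ℤ, (T ^ n) a = b := by
      intro a b hab
      induction hab with
      | rel a b h => exact ⟨1, by simpa using (hT _ _).1 h⟩
      | refl a => exact ⟨0, by simp⟩
      | symm a b _ ih =>
        obtain ⟨n, rfl⟩ := ih
        exact ⟨-n, by rw [← Equiv.Perm.mul_apply, ← zpow_add]; simp⟩
      | trans a b c _ _ ih1 ih2 =>
        obtain ⟨n, rfl⟩ := ih1
        obtain ⟨m, rfl⟩ := ih2
        exact ⟨m + n, by rw [zpow_add, Equiv.Perm.mul_apply]⟩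
    exact key _ _ (hg x (Set.mem_univ x) g)
  · rintro ⟨n, rfl⟩
    induction n with
    | zero => exact ⟨1, by simp⟩
    | succ n ih =>
      obtain ⟨g, hg⟩ := ih
      obtain ⟨k, hk⟩ := hE _ _ (ht ((T ^ (n : ℤ)) x))
      refine ⟨k * g, ?_⟩
      rw [mul_smul, hg, hk, add_comm, zpow_add, Equiv.Perm.mul_apply]; rfl
    | pred n ih =>
      obtain ⟨g, hg⟩ := ih
      obtain ⟨k, hk⟩ := hE _ _ (hp ((T ^ (-n : ℤ)) x))
      refine ⟨k⁻¹ * g, ?_⟩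
      rw [mul_smul, hg]
      rw [inv_smul_eq_iff]
      have : (T ^ (-(n : ℤ) - 1)) x = p ((T ^ (-n : ℤ)) x) := by
        rw [sub_eq_add_neg, add_comm, zpow_add, Equiv.Perm.mul_apply, zpow_neg_one]; rfl
      rw [this, hk]

theorem vc_glue {Γ X : Type*} [Group Γ] [Countable Γ] [MeasurableSpace X] [MulAction Γ X]
    [MeasurableConstSMul Γ X] (V W : Set X) (hW : MeasurableSet W)
    (hinv : ∀ (g : Γ) x, g • x ∈ W ↔ x ∈ W)
    (h1 : VCGood Γ (W ∩ V)) (h2 : VCGood Γ (Wᶜ ∩ V)) : VCGood Γ V := by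
  obtain ⟨G1, hm1, hE1, hs1, hp1, hg1⟩ := h1
  obtain ⟨G2, hm2, hE2, hs2, hp2, hg2⟩ := h2
  let G : X → X → Prop := fun x y => (x ∈ W ∧ G1 x y) ∨ (x ∉ W ∧ G2 x y)
  have i1 : ∀ x y, G1 x y → (x ∈ W ↔ y ∈ W) := by
    intro x y h
    obtain ⟨g, rfl⟩ := hE1 _ _ h
    rw [hinv]
  have i2 : ∀ x y, G2 x y → (x ∈ W ↔ y ∈ W) := by
    intro x y h
    obtain ⟨g, rfl⟩ := hE2 _ _ h
    rw [hinv]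
  have g1 : ∀ a b, Relation.EqvGen G1 a b → (a ∈ W ↔ b ∈ W) ∧ (a ∈ W → Relation.EqvGen G a b) := by
    intro a b hab
    induction hab with
    | rel a b h => exact ⟨i1 _ _ h, fun ha => .rel _ _ (Or.inl ⟨ha, h⟩)⟩
    | refl a => exact ⟨Iff.rfl, fun _ => .refl _⟩
    | symm a b _ ih => exact ⟨ih.1.symm, fun hb => .symm _ _ (ih.2 (ih.1.2 hb))⟩
    | trans a b c _ _ ih1 ih2 =>
      exact ⟨ih1.1.trans ih2.1, fun ha => .trans _ _ _ (ih1.2 ha) (ih2.2 (ih1.1.1 ha))⟩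
  have g2 : ∀ a b, Relation.EqvGen G2 a b → (a ∈ W ↔ b ∈ W) ∧ (a ∉ W → Relation.EqvGen G a b) := by
    intro a b hab
    induction hab with
    | rel a b h => exact ⟨i2 _ _ h, fun ha => .rel _ _ (Or.inr ⟨ha, h⟩)⟩
    | refl a => exact ⟨Iff.rfl, fun _ => .refl _⟩
    | symm a b _ ih => exact ⟨ih.1.symm, fun hb => .symm _ _ (ih.2 (fun h => hb (ih.1.1 h)))⟩
    | trans a b c _ _ ih1 ih2 =>
      exact ⟨ih1.1.trans ih2.1, fun ha => .trans _ _ _ (ih1.2 ha) (ih2.2 (fun h => ha (ih1.1.2 h)))⟩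
  refine ⟨G, fun g => ?_, ?_, ?_, ?_, ?_⟩
  · exact (hW.inter (hm1 g)).union (hW.compl.inter (hm2 g))
  · rintro x y (⟨_, h⟩ | ⟨_, h⟩)
    · exact hE1 _ _ h
    · exact hE2 _ _ h
  · intro x hx
    by_cases hxW : x ∈ W
    · obtain ⟨y, hy, hy'⟩ := hs1 x ⟨hxW, hx⟩
      refine ⟨y, Or.inl ⟨hxW, hy⟩, ?_⟩
      rintro z (⟨_, h⟩ | ⟨h, _⟩)
      · exact hy' _ h
      · exact absurd hxW h
    · obtain ⟨y, hy, hy'⟩ := hs2 x ⟨hxW, hx⟩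
      refine ⟨y, Or.inr ⟨hxW, hy⟩, ?_⟩
      rintro z (⟨h, _⟩ | ⟨_, h⟩)
      · exact absurd h hxW
      · exact hy' _ h
  · intro x hx
    by_cases hxW : x ∈ W
    · obtain ⟨y, hy, hy'⟩ := hp1 x ⟨hxW, hx⟩
      refine ⟨y, Or.inl ⟨(i1 _ _ hy).2 hxW, hy⟩, ?_⟩
      rintro z (⟨_, h⟩ | ⟨h, h'⟩)
      · exact hy' _ h
      · exact absurd ((i2 _ _ h').2 hxW) h
    · obtain ⟨y, hy, hy'⟩ := hp2 x ⟨hxW, hx⟩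
      refine ⟨y, Or.inr ⟨fun h => hxW ((i2 _ _ hy).1 h), hy⟩, ?_⟩
      rintro z (⟨h, h'⟩ | ⟨_, h⟩)
      · exact absurd ((i1 _ _ h').1 h) hxW
      · exact hy' _ h
  · intro x hx g
    by_cases hxW : x ∈ W
    · exact (g1 _ _ (hg1 x ⟨hxW, hx⟩ g)).2 hxW
    · exact (g2 _ _ (hg2 x ⟨hxW, hx⟩ g)).2 hxW

/-- rank function from a partial selector -/
theorem vc_rank {Γ X : Type*} [Group Γ] [Countable Γ] [MeasurableSpace X] [MulAction Γ X]
    [MeasurableConstSMul Γ X] (S : Set X) (hS : MeasurableSet S)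
    (hsel : ∀ x ∈ S, ∀ g : Γ, g • x ∈ S → g • x = x) :
    ∃ ρ : X → ℕ, Measurable ρ ∧ ∀ x, (∃ g : Γ, g • x ∈ S) →
      (∀ g : Γ, ρ (g • x) = ρ x → g • x = x) ∧ ∀ k < ρ x, ∃ g : Γ, ρ (g • x) = k := by
  classical
  obtain ⟨γ, hγ⟩ := exists_surjective_nat Γ
  let D : Set X := {x | ∃ g : Γ, g • x ∈ S}
  have hD : MeasurableSet D := by
    have : D = ⋃ g : Γ, (fun x => g • x) ⁻¹' S := by ext; simp [D]
    rw [this]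
    exact MeasurableSet.iUnion fun g => measurable_const_smul g hS
  have hDinv : ∀ x ∈ D, ∀ g : Γ, g • x ∈ D := by
    rintro x ⟨k, hk⟩ g
    exact ⟨k * g⁻¹, by simpa [smul_smul] using hk⟩
  have hex : ∀ x, ∃ i, γ i • x ∈ S ∨ x ∉ D := by
    intro x
    by_cases hx : x ∈ D
    · obtain ⟨g, hg⟩ := hx
      obtain ⟨i, rfl⟩ := hγ g
      exact ⟨i, Or.inl hg⟩
    · exact ⟨0, Or.inr hx⟩
  let r : X → ℕ := fun x => Nat.find (hex x)
  have hr : Measurable r := measurable_find hex fun k =>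
    (measurable_const_smul (γ k) hS).union hD.compl
  have hrS : ∀ x ∈ D, γ (r x) • x ∈ S := fun x hx =>
    (Nat.find_spec (hex x)).resolve_right (fun h => h hx)
  have hrinj : ∀ x ∈ D, ∀ g : Γ, r (g • x) = r x → g • x = x := by
    intro x hx g hg
    have h1 := hrS x hx
    have h2 := hrS _ (hDinv x hx g)
    rw [hg] at h2
    have h3 := hsel _ h1 (γ (r x) * g * (γ (r x))⁻¹) (by simpa [smul_smul] using h2)
    have h4 : γ (r x) • (g • x) = γ (r x) • x := by simpa [smul_smul] using h3
    exact smul_left_cancel _ h4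
  let p : X → ℕ → Prop := fun x j => ∃ g : Γ, r (g • x) = j
  have hpinv : ∀ x (g : Γ), p (g • x) = p x := by
    intro x g
    ext j
    constructor
    · rintro ⟨k, hk⟩; exact ⟨k * g, by rw [mul_smul]; exact hk⟩
    · rintro ⟨k, hk⟩; exact ⟨k * g⁻¹, by rw [mul_smul, inv_smul_smul]; exact hk⟩
  have hpm : ∀ j, MeasurableSet {x | p x j} := by
    intro j
    have : {x | p x j} = ⋃ g : Γ, (fun x => r (g • x)) ⁻¹' {j} := by ext; simp [p]
    rw [this]
    exact MeasurableSet.iUnion fun g =>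
      (hr.comp (measurable_const_smul g)) (MeasurableSet.singleton j)
  let ρ : X → ℕ := fun x => Nat.count (p x) (r x)
  have hcm : ∀ n, Measurable fun x => Nat.count (p x) n := by
    intro n
    induction n with
    | zero => simp
    | succ n ih =>
      simp only [Nat.count_succ]
      exact ih.add (Measurable.ite (hpm n) measurable_const measurable_const)
  refine ⟨ρ, ?_, ?_⟩
  · refine measurable_to_countable' fun k => ?_
    have : ρ ⁻¹' {k} = ⋃ n : ℕ, r ⁻¹' {n} ∩ (fun x => Nat.count (p x) n) ⁻¹' {k} := by
      ext x; simp [ρ]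
    rw [this]
    exact MeasurableSet.iUnion fun n => (hr (MeasurableSet.singleton n)).inter
      (hcm n (MeasurableSet.singleton k))
  · intro x hx
    constructor
    · intro g hg
      apply hrinj x hx
      have hg' : Nat.count (p x) (r (g • x)) = Nat.count (p x) (r x) := by
        have h0 : Nat.count (p (g • x)) (r (g • x)) = Nat.count (p x) (r x) := hg
        have h1 : Nat.count (p (g • x)) (r (g • x)) = Nat.count (p x) (r (g • x)) := by
          congr 1
          exact hpinv x g
        omega
      rcases lt_trichotomy (r (g • x)) (r x) with h | h | h
      · exact absurd hg' (Nat.count_strict_mono ⟨g, rfl⟩ h).ne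
      · exact h
      · exact absurd hg' (Nat.count_strict_mono ⟨1, by simp⟩ h).ne'
    · have key : ∀ m, ∀ k < Nat.count (p x) m, ∃ j, p x j ∧ Nat.count (p x) j = k := by
        intro m
        induction m with
        | zero => simp
        | succ m ih =>
          intro k hk
          by_cases h : k < Nat.count (p x) m
          · exact ih k h
          · rw [Nat.count_succ] at hk
            split_ifs at hk with hpm
            · exact ⟨m, hpm, by omega⟩
            · omega
      intro k hk
      obtain ⟨j, ⟨g, hg⟩, hj⟩ := key _ k hk
      refine ⟨g, ?_⟩
      have h1 : ρ (g • x) = Nat.count (p x) (r (g • x)) := by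
        simp only [ρ]
        congr 1
        exact hpinv x g
      rw [h1, hg, hj]

theorem vc_smooth {Γ X : Type*} [Group Γ] [Countable Γ] [MeasurableSpace X] [MulAction Γ X]
    [MeasurableConstSMul Γ X] (S : Set X) (hS : MeasurableSet S)
    (hsel : ∀ x ∈ S, ∀ g : Γ, g • x ∈ S → g • x = x) :
    VCGood Γ {x : X | ∃ g : Γ, g • x ∈ S} := by
  obtain ⟨ρ, hρ, hD⟩ := vc_rank S hS hsel
  set D : Set X := {x : X | ∃ g : Γ, g • x ∈ S} with hDdef
  have hDinv : ∀ x ∈ D, ∀ g : Γ, g • x ∈ D := by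
    rintro x ⟨k, hk⟩ g
    exact ⟨k * g⁻¹, by simpa [smul_smul] using hk⟩
  have hinj : ∀ x ∈ D, ∀ g k : Γ, ρ (g • x) = ρ (k • x) → g • x = k • x := by
    intro x hx g k h
    have := (hD _ (hDinv x hx k)).1 (g * k⁻¹)
    simp only [mul_smul, inv_smul_smul] at this
    exact this h
  have hini : ∀ x ∈ D, ∀ g : Γ, ∀ k < ρ (g • x), ∃ l : Γ, ρ (l • x) = k := by
    intro x hx g k h
    obtain ⟨l, hl⟩ := (hD _ (hDinv x hx g)).2 k h
    exact ⟨l * g, by rw [mul_smul]; exact hl⟩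
  have hρg : ∀ g : Γ, Measurable fun x => ρ (g • x) := fun g => hρ.comp (measurable_const_smul g)
  let V : Set X := {x | ∀ k, ∃ g : Γ, ρ (g • x) = k}
  have hV : MeasurableSet V := by
    have : V = ⋂ k, ⋃ g : Γ, (fun x => ρ (g • x)) ⁻¹' {k} := by ext; simp [V]
    rw [this]
    exact MeasurableSet.iInter fun k => MeasurableSet.iUnion fun g =>
      hρg g (MeasurableSet.singleton k)
  have hVi : ∀ (g : Γ) x, g • x ∈ V ↔ x ∈ V := by
    intro g x
    constructor
    · intro h k
      obtain ⟨l, hl⟩ := h k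
      exact ⟨l * g, by rw [mul_smul]; exact hl⟩
    · intro h k
      obtain ⟨l, hl⟩ := h k
      exact ⟨l * g⁻¹, by rw [mul_smul, inv_smul_smul]; exact hl⟩
  refine vc_glue (Γ := Γ) D V hV hVi ?_ ?_
  · let ψ : ℕ ≃ ℤ := Equiv.intEquivNat.symm
    have hatt : ∀ x ∈ V, ∀ n : ℤ, ∃ g : Γ, ψ (ρ (g • x)) = n := by
      intro x hx n
      obtain ⟨g, hg⟩ := hx (ψ.symm n)
      exact ⟨g, by rw [hg]; simp⟩
    refine ⟨fun x y => (∃ g : Γ, g • x = y) ∧ ψ (ρ y) = ψ (ρ x) + 1, ?_, ?_, ?_, ?_, ?_⟩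
    · intro g
      have : {x : X | (∃ k : Γ, k • x = g • x) ∧ ψ (ρ (g • x)) = ψ (ρ x) + 1} =
          {x : X | ψ (ρ (g • x)) = ψ (ρ x) + 1} := by
        ext x
        simp only [Set.mem_ofPred_eq, and_iff_right_iff_imp]
        exact fun _ => ⟨g, rfl⟩
      rw [this]
      exact measurableSet_eq_fun (Measurable.of_discrete.comp (hρg g))
        ((Measurable.of_discrete (f := fun n => ψ n + 1)).comp hρ)
    · exact fun x y h => h.1
    · rintro x ⟨hx, hxD⟩
      obtain ⟨g, hg⟩ := hatt x hx (ψ (ρ x) + 1)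
      refine ⟨g • x, ⟨⟨g, rfl⟩, hg⟩, ?_⟩
      rintro _ ⟨⟨k, rfl⟩, hk⟩
      exact hinj x hxD _ _ (ψ.injective (by rw [hk, hg]))
    · rintro x ⟨hx, hxD⟩
      obtain ⟨g, hg⟩ := hatt x hx (ψ (ρ x) - 1)
      refine ⟨g • x, ⟨⟨g⁻¹, by simp⟩, by rw [hg]; ring⟩, ?_⟩
      rintro z ⟨⟨k, rfl⟩, hk⟩
      have := hinj _ hxD k⁻¹ g (ψ.injective (by rw [hg, hk]; simp))
      simpa using this
    · rintro x ⟨hx, hxD⟩ g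
      set G : X → X → Prop := fun x y => (∃ g : Γ, g • x = y) ∧ ψ (ρ y) = ψ (ρ x) + 1
      have key : ∀ n : ℕ, ∀ a b : Γ, ψ (ρ (b • x)) = ψ (ρ (a • x)) + n →
          Relation.EqvGen G (a • x) (b • x) := by
        intro n
        induction n with
        | zero =>
          intro a b h
          rw [hinj x hxD b a (ψ.injective (by simpa using h))]
          exact .refl _
        | succ n ih =>
          intro a b h
          obtain ⟨c, hc⟩ := hatt x hx (ψ (ρ (a • x)) + n)
          refine .trans _ _ _ (ih a c hc) (.rel _ _ ⟨⟨b * c⁻¹, by simp [mul_smul]⟩, ?_⟩)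
          rw [h, hc]; push_cast; ring
      rcases le_total (ψ (ρ x)) (ψ (ρ (g • x))) with h | h
      · obtain ⟨n, hn⟩ := Int.le.dest h
        have := key n 1 g (by rw [one_smul]; exact hn.symm)
        rwa [one_smul] at this
      · obtain ⟨n, hn⟩ := Int.le.dest h
        have := key n g 1 (by rw [one_smul]; exact hn.symm)
        rw [one_smul] at this
        exact .symm _ _ this
  · let G : X → X → Prop := fun x y => (∃ g : Γ, g • x = y) ∧
      (ρ y = ρ x + 1 ∨ (ρ y = 0 ∧ ∀ g : Γ, ρ (g • x) ≠ ρ x + 1))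
    have hz : ∀ x ∈ D, ∃ g : Γ, ρ (g • x) = 0 := by
      intro x hx
      rcases Nat.eq_zero_or_pos (ρ x) with h | h
      · exact ⟨1, by simpa using h⟩
      · exact (hD x hx).2 0 h
    refine ⟨G, ?_, ?_, ?_, ?_, ?_⟩
    · intro g
      have : {x : X | G x (g • x)} =
          {x : X | ρ (g • x) = ρ x + 1} ∪ ({x : X | ρ (g • x) = 0} ∩
            ⋂ k : Γ, {x : X | ρ (k • x) = ρ x + 1}ᶜ) := by
        ext x
        simp only [Set.mem_ofPred_eq, Set.mem_union, Set.mem_inter_iff, Set.mem_iInter,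
          Set.mem_compl_iff, G]
        constructor
        · exact fun h => h.2
        · exact fun h => ⟨⟨g, rfl⟩, h⟩
      rw [this]
      have hh : ∀ k : Γ, MeasurableSet {x : X | ρ (k • x) = ρ x + 1} := fun k =>
        measurableSet_eq_fun (hρg k) (hρ.add measurable_const)
      exact (hh g).union ((measurableSet_eq_fun (hρg g) measurable_const).inter
        (MeasurableSet.iInter fun k => (hh k).compl))
    · exact fun x y h => h.1
    · rintro x ⟨hx, hxD⟩
      by_cases h : ∃ g : Γ, ρ (g • x) = ρ x + 1
      · obtain ⟨g, hg⟩ := h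
        refine ⟨g • x, ⟨⟨g, rfl⟩, Or.inl hg⟩, ?_⟩
        rintro _ ⟨⟨k, rfl⟩, hk | hk⟩
        · exact hinj x hxD _ _ (hk.trans hg.symm)
        · exact absurd hg (hk.2 g)
      · push Not at h
        obtain ⟨g, hg⟩ := hz x hxD
        refine ⟨g • x, ⟨⟨g, rfl⟩, Or.inr ⟨hg, h⟩⟩, ?_⟩
        rintro _ ⟨⟨k, rfl⟩, hk | hk⟩
        · exact absurd hk (h k)
        · exact hinj x hxD _ _ (hk.1.trans hg.symm)
    · rintro x ⟨hx, hxD⟩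
      rcases Nat.eq_zero_or_pos (ρ x) with h0 | h0
      · have hx' : ∃ k, ¬ ∃ g : Γ, ρ (g • x) = k := by
          by_contra hcon
          push Not at hcon
          exact hx hcon
        classical
        have hm := Nat.find_spec hx'
        have hmin : ∀ j < Nat.find hx', ∃ g : Γ, ρ (g • x) = j := fun j hj =>
          not_not.1 (Nat.find_min hx' hj)
        set m := Nat.find hx'
        have hm0 : m ≠ 0 := fun h => hm ⟨1, by rw [h]; simpa using h0⟩
        have hbd : ∀ g : Γ, ρ (g • x) < m := by
          intro g
          by_contra hcon
          rcases (not_lt.1 hcon).eq_or_lt with h | h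
          · exact hm ⟨g, h.symm⟩
          · exact hm (hini x hxD g m h)
        obtain ⟨g, hg⟩ := hmin (m - 1) (by omega)
        refine ⟨g • x, ⟨⟨g⁻¹, by simp⟩, Or.inr ⟨h0, ?_⟩⟩, ?_⟩
        · intro k hk
          have := hbd (k * g)
          rw [mul_smul] at this
          omega
        · rintro z ⟨⟨k, rfl⟩, hk | hk⟩
          · omega
          · have h1 : ρ z < m := by simpa using hbd k⁻¹
            have h2 : ¬ (ρ z + 1 < m) := by
              intro h
              obtain ⟨l, hl⟩ := hmin _ h
              exact hk.2 (l * k) (by rw [mul_smul]; exact hl)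
            have := hinj _ hxD k⁻¹ g (by rw [hg]; simp; omega)
            simpa using this
      · obtain ⟨g, hg⟩ := (hD x hxD).2 (ρ x - 1) (by omega)
        refine ⟨g • x, ⟨⟨g⁻¹, by simp⟩, Or.inl (by omega)⟩, ?_⟩
        rintro z ⟨⟨k, rfl⟩, hk | hk⟩
        · have := hinj _ hxD k⁻¹ g (by rw [hg]; simp; omega)
          simpa using this
        · omega
    · rintro x ⟨hx, hxD⟩ g
      obtain ⟨o, ho⟩ := hz x hxD
      have key : ∀ n : ℕ, ∀ b : Γ, ρ (b • x) = n → Relation.EqvGen G (o • x) (b • x) := by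
        intro n
        induction n with
        | zero =>
          intro b h
          rw [hinj x hxD b o (by omega)]
          exact .refl _
        | succ n ih =>
          intro b h
          obtain ⟨c, hc⟩ := hini x hxD b n (by omega)
          refine .trans _ _ _ (ih c hc) (.rel _ _ ⟨⟨b * c⁻¹, by simp [mul_smul]⟩, Or.inl ?_⟩)
          omega
      have h1 := key _ 1 rfl
      rw [one_smul] at h1
      exact .trans _ _ _ (.symm _ _ h1) (key _ g rfl)

theorem vc_order {α : Type*} [LinearOrder α] (hfin : ∀ a b : α, (Set.Ioo a b).Finite)
    (hmax : ∀ a : α, ∃ b, a < b) (hmin : ∀ a : α, ∃ b, b < a) :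
    (∀ a : α, ∃ b, a ⋖ b) ∧ (∀ a : α, ∃ b, b ⋖ a) ∧
      ∀ a b : α, Relation.EqvGen (fun x y => x ⋖ y) a b := by
  have hIcc : ∀ a b : α, (Set.Icc a b).Finite := by
    intro a b
    refine ((hfin a b).union (Set.toFinite {a, b})).subset ?_
    intro z hz
    rcases hz.1.eq_or_lt with h | h
    · right; simp [h]
    · rcases hz.2.eq_or_lt with h' | h'
      · right; simp [h']
      · left; exact ⟨h, h'⟩
  letI : LocallyFiniteOrder α := LocallyFiniteOrder.ofFiniteIcc hIcc
  refine ⟨fun a => ?_, fun a => ?_, ?_⟩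
  · obtain ⟨b, hb⟩ := hmax a
    obtain ⟨c, hc, _⟩ := exists_covBy_le_of_lt hb
    exact ⟨c, hc⟩
  · obtain ⟨b, hb⟩ := hmin a
    obtain ⟨c, _, hc⟩ := exists_le_covBy_of_lt hb
    exact ⟨c, hc⟩
  · have key : ∀ a b : α, a ≤ b → Relation.EqvGen (fun x y => x ⋖ y) a b := by
      intro a b hab
      rw [le_iff_reflTransGen_covBy] at hab
      induction hab with
      | refl => exact .refl _
      | tail _ h ih => exact .trans _ _ _ ih (.rel _ _ h)
    intro a b
    rcases le_total a b with h | h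
    · exact key _ _ h
    · exact .symm _ _ (key _ _ h)

/-- The last-difference order. -/
def vclt {X : Type*} (c : ℕ → X → ℝ) (x y : X) : Prop :=
  ∃ k, c k x < c k y ∧ c (k + 1) x = c (k + 1) y

theorem vclt_facts {α : Type*} (c : ℕ → α → ℝ)
    (hstep : ∀ n x y, c n x = c n y → c (n + 1) x = c (n + 1) y)
    (hall : ∀ x y, ∃ n, c n x = c n y) (h0 : ∀ x y, c 0 x = c 0 y → x = y) :
    (∀ x, ¬ vclt c x x) ∧ (∀ x y z, vclt c x y → vclt c y z → vclt c x z) ∧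
    (∀ x y, x = y ∨ vclt c x y ∨ vclt c y x) ∧
    (∀ n x y z, c n x = c n y → vclt c x z → vclt c z y → c n z = c n x) := by
  have hmono : ∀ n m x y, n ≤ m → c n x = c n y → c m x = c m y := by
    intro n m x y hnm h
    induction hnm with
    | refl => exact h
    | step _ ih => exact hstep _ _ _ ih
  have hirr : ∀ x, ¬ vclt c x x := fun x ⟨k, hk, _⟩ => lt_irrefl _ hk
  have htr : ∀ x y z, vclt c x y → vclt c y z → vclt c x z := by
    rintro x y z ⟨k, hk, hk'⟩ ⟨l, hl, hl'⟩
    rcases lt_trichotomy k l with h | h | h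
    · refine ⟨l, ?_, ?_⟩
      · rw [hmono _ l _ _ h hk']; exact hl
      · rw [hmono _ (l + 1) _ _ (by omega) hk']; exact hl'
    · subst h
      exact ⟨k, hk.trans hl, hk'.trans hl'⟩
    · refine ⟨k, ?_, ?_⟩
      · rw [← hmono _ k _ _ h hl']; exact hk
      · rw [← hmono _ (k + 1) _ _ (by omega) hl']; exact hk'
  refine ⟨hirr, htr, ?_, ?_⟩
  · intro x y
    classical
    by_cases hxy : x = y
    · exact Or.inl hxy
    right
    have hs := Nat.find_spec (hall x y)
    have hm := fun m => Nat.find_min (hall x y) (m := m)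
    set n := Nat.find (hall x y)
    rcases Nat.eq_zero_or_pos n with h | h
    · rw [h] at hs
      exact absurd (h0 _ _ hs) hxy
    · have h1 := hm (n - 1) (by omega)
      have h2 : n - 1 + 1 = n := by omega
      rcases lt_or_gt_of_ne h1 with h3 | h3
      · left; exact ⟨n - 1, h3, by rw [h2]; exact hs⟩
      · right; exact ⟨n - 1, h3, by rw [h2]; exact hs.symm⟩
  · rintro n x y z hxy ⟨k, hk, hk'⟩ hzy
    by_cases h : k < n
    · exact (hmono _ n _ _ h hk').symm
    · exfalso
      have hyk : c k x = c k y := hmono _ k _ _ (by omega) hxy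
      have hyk' := hstep _ _ _ hyk
      have : vclt c y z := ⟨k, by rw [← hyk]; exact hk, by rw [← hyk']; exact hk'⟩
      exact hirr _ (htr _ _ _ this hzy)

theorem vc_zeta {Γ X : Type*} [Group Γ] [Countable Γ] [MeasurableSpace X] [MulAction Γ X]
    [MeasurableConstSMul Γ X] (c : ℕ → X → ℝ) (hc : ∀ n, Measurable (c n)) (W : Set X)
    (hWi : ∀ x ∈ W, ∀ g : Γ, g • x ∈ W)
    (hstep : ∀ n, ∀ x ∈ W, ∀ g : Γ, c n x = c n (g • x) → c (n + 1) x = c (n + 1) (g • x))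
    (hall : ∀ x ∈ W, ∀ g : Γ, ∃ n, c n x = c n (g • x))
    (h0 : ∀ x ∈ W, ∀ g : Γ, c 0 x = c 0 (g • x) → x = g • x)
    (hfin : ∀ n, ∀ x ∈ W, {y | (∃ g : Γ, g • x = y) ∧ c n y = c n x}.Finite)
    (hmax : ∀ x ∈ W, ∃ g : Γ, vclt c x (g • x))
    (hmin : ∀ x ∈ W, ∃ g : Γ, vclt c (g • x) x) : VCGood Γ W := by
  classical
  let G : X → X → Prop := fun x y => (∃ g : Γ, g • x = y) ∧ vclt c x y ∧
    ∀ g : Γ, ¬ (vclt c x (g • x) ∧ vclt c (g • x) y)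
  have main : ∀ x ∈ W, (∃ y, G x y ∧ ∀ z, G x z → z = y) ∧ (∃ y, G y x ∧ ∀ z, G z x → z = y) ∧
      ∀ g : Γ, Relation.EqvGen G x (g • x) := by
    intro x hx
    let α := {y : X // ∃ g : Γ, g • x = y}
    have hαW : ∀ y : α, y.1 ∈ W := by
      rintro ⟨_, g, rfl⟩; exact hWi x hx g
    have hαE : ∀ y z : α, ∃ g : Γ, g • y.1 = z.1 := by
      rintro ⟨_, g, rfl⟩ ⟨_, k, rfl⟩
      exact ⟨k * g⁻¹, by simp [mul_smul]⟩
    have hαS : ∀ (y : α) (g : Γ), ∃ k : Γ, k • x = g • y.1 := by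
      rintro ⟨_, g, rfl⟩ k
      exact ⟨k * g, by simp [mul_smul]⟩
    let d : ℕ → α → ℝ := fun n y => c n y.1
    obtain ⟨f1, f2, f3, f4⟩ := vclt_facts d
      (by
        intro n y z h
        obtain ⟨g, hg⟩ := hαE y z
        have := hstep n y.1 (hαW y) g
        rw [hg] at this
        exact this h)
      (by
        intro y z
        obtain ⟨g, hg⟩ := hαE y z
        have := hall y.1 (hαW y) g
        rw [hg] at this
        exact this)
      (by
        intro y z h
        obtain ⟨g, hg⟩ := hαE y z
        have := h0 y.1 (hαW y) g
        rw [hg] at this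
        exact Subtype.ext (this h))
    letI : LinearOrder α :=
      { le := fun y z => y = z ∨ vclt d y z
        lt := fun y z => vclt d y z
        le_refl := fun y => Or.inl rfl
        le_trans := by
          rintro a b e (rfl | h) (rfl | h')
          · exact Or.inl rfl
          · exact Or.inr h'
          · exact Or.inr h
          · exact Or.inr (f2 _ _ _ h h')
        le_antisymm := by
          rintro a b (rfl | h) (h' | h')
          · rfl
          · rfl
          · exact h'.symm
          · exact absurd (f2 _ _ _ h h') (f1 _)
        lt_iff_le_not_ge := by
          intro a b
          constructor
          · intro h
            refine ⟨Or.inr h, ?_⟩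
            rintro (rfl | h')
            · exact f1 _ h
            · exact f1 _ (f2 _ _ _ h h')
          · rintro ⟨rfl | h, h'⟩
            · exact absurd (Or.inl rfl) h'
            · exact h
        le_total := by
          intro a b
          rcases f3 a b with h | h | h
          · exact Or.inl (Or.inl h)
          · exact Or.inl (Or.inr h)
          · exact Or.inr (Or.inr h)
        toDecidableLE := Classical.decRel _ }
    have hlt : ∀ y z : α, y < z ↔ vclt c y.1 z.1 := fun y z => Iff.rfl
    have hcov : ∀ y z : α, y ⋖ z ↔ G y.1 z.1 := by
      intro y z
      constructor
      · rintro ⟨h1, h2⟩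
        refine ⟨hαE y z, h1, ?_⟩
        rintro g ⟨h3, h4⟩
        exact h2 (c := ⟨g • y.1, hαS y g⟩) h3 h4
      · rintro ⟨_, h1, h2⟩
        refine ⟨h1, ?_⟩
        intro a h3 h4
        obtain ⟨g, hg⟩ := hαE y a
        apply h2 g
        rw [hg]
        exact ⟨h3, h4⟩
    obtain ⟨o1, o2, o3⟩ := vc_order (α := α)
      (by
        intro a b
        obtain ⟨g, hg⟩ := hαE a b
        obtain ⟨n, hn⟩ := hall a.1 (hαW a) g
        rw [hg] at hn
        have hf := (hfin n a.1 (hαW a)).preimage (f := fun z : α => z.1)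
          Subtype.val_injective.injOn
        refine hf.subset ?_
        rintro z ⟨hz1, hz2⟩
        exact ⟨hαE a z, f4 n a b z hn hz1 hz2⟩)
      (by
        intro a
        obtain ⟨g, hg⟩ := hmax a.1 (hαW a)
        exact ⟨⟨g • a.1, hαS a g⟩, hg⟩)
      (by
        intro a
        obtain ⟨g, hg⟩ := hmin a.1 (hαW a)
        exact ⟨⟨g • a.1, hαS a g⟩, hg⟩)
    let x' : α := ⟨x, 1, one_smul _ _⟩
    refine ⟨?_, ?_, ?_⟩
    · obtain ⟨y, hy⟩ := o1 x'
      refine ⟨y.1, (hcov _ _).1 hy, fun z hz => ?_⟩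
      have h1 : x' ⋖ (⟨z, hz.1⟩ : α) := (hcov _ _).2 hz
      exact congrArg Subtype.val (h1.unique_right hy)
    · obtain ⟨y, hy⟩ := o2 x'
      refine ⟨y.1, (hcov _ _).1 hy, fun z hz => ?_⟩
      obtain ⟨g, hg⟩ := hz.1
      have h1 : (⟨z, g⁻¹, by rw [inv_smul_eq_iff]; exact hg.symm⟩ : α) ⋖ x' := (hcov _ _).2 hz
      exact congrArg Subtype.val (h1.unique_left hy)
    · intro g
      have h2 : ∀ a b : α, Relation.EqvGen (fun x y : α => x ⋖ y) a b →
          Relation.EqvGen G a.1 b.1 := by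
        intro a b hab
        induction hab with
        | rel a b h => exact .rel _ _ ((hcov _ _).1 h)
        | refl a => exact .refl _
        | symm a b _ ih => exact .symm _ _ ih
        | trans a b c _ _ ih1 ih2 => exact .trans _ _ _ ih1 ih2
      exact h2 _ _ (o3 x' ⟨g • x, g, rfl⟩)
  have hltm : ∀ (g k : Γ), MeasurableSet {x : X | vclt c (g • x) (k • x)} := by
    intro g k
    have : {x : X | vclt c (g • x) (k • x)} = ⋃ n : ℕ,
        {x : X | c n (g • x) < c n (k • x)} ∩ {x : X | c (n + 1) (g • x) = c (n + 1) (k • x)} := by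
      ext x; simp [vclt]
    rw [this]
    have hcg : ∀ n (g : Γ), Measurable fun x => c n (g • x) := fun n g =>
      (hc n).comp (measurable_const_smul g)
    exact MeasurableSet.iUnion fun n => (measurableSet_lt (hcg _ _) (hcg _ _)).inter
      (measurableSet_eq_fun (hcg _ _) (hcg _ _))
  refine ⟨G, ?_, fun x y h => h.1, fun x hx => (main x hx).1, fun x hx => (main x hx).2.1,
    fun x hx => (main x hx).2.2⟩
  intro g
  have : {x : X | G x (g • x)} = {x : X | vclt c ((1 : Γ) • x) (g • x)} ∩
      ⋂ k : Γ, ({x : X | vclt c ((1 : Γ) • x) (k • x)} ∩ {x : X | vclt c (k • x) (g • x)})ᶜ := by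
    ext x
    simp only [Set.mem_ofPred_eq, Set.mem_inter_iff, Set.mem_iInter,
          Set.mem_compl_iff, G, one_smul]
    constructor
    · exact fun h => h.2
    · exact fun h => ⟨⟨g, rfl⟩, h⟩
  rw [this]
  exact (hltm _ _).inter (MeasurableSet.iInter fun k => ((hltm _ _).inter (hltm _ _)).compl)

theorem vc_select {Γ X : Type*} [Group Γ] [Countable Γ] [MeasurableSpace X] [MulAction Γ X]
    [MeasurableConstSMul Γ X] (f : X → ℝ) (hf : Measurable f) (hfi : Function.Injective f)
    (S : Set X) (hS : MeasurableSet S)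
    (hof : ∀ x, {y | (∃ g : Γ, g • x = y) ∧ y ∈ S}.Finite) :
    ∃ S' : Set X, MeasurableSet S' ∧ (∀ x ∈ S', ∀ g : Γ, g • x ∈ S' → g • x = x) ∧
      ∀ x, (∃ g : Γ, g • x ∈ S') ↔ ∃ g : Γ, g • x ∈ S := by
  refine ⟨{x | x ∈ S ∧ ∀ g : Γ, g • x ∈ S → f x ≤ f (g • x)}, ?_, ?_, ?_⟩
  · have : {x | x ∈ S ∧ ∀ g : Γ, g • x ∈ S → f x ≤ f (g • x)} =
        S ∩ ⋂ g : Γ, ((fun x => g • x) ⁻¹' S)ᶜ ∪ {x | f x ≤ f (g • x)} := by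
      ext x
      simp only [Set.mem_ofPred_eq, Set.mem_inter_iff, Set.mem_iInter, Set.mem_union,
        Set.mem_compl_iff, Set.mem_preimage, imp_iff_not_or]
    rw [this]
    exact hS.inter (MeasurableSet.iInter fun g => (measurable_const_smul g hS).compl.union
      (measurableSet_le hf (hf.comp (measurable_const_smul g))))
  · rintro x ⟨h1, h2⟩ g ⟨h3, h4⟩
    apply hfi
    have := h4 g⁻¹ (by simpa using h1)
    rw [inv_smul_smul] at this
    exact le_antisymm this (h2 g h3)
  · intro x
    constructor
    · rintro ⟨g, hg⟩; exact ⟨g, hg.1⟩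
    · rintro ⟨g, hg⟩
      obtain ⟨y, ⟨⟨k, rfl⟩, hy⟩, hy'⟩ := Set.exists_min_image _ f (hof x) ⟨g • x, ⟨g, rfl⟩, hg⟩
      refine ⟨k, hy, fun l hl => hy' _ ⟨⟨l * k, by rw [mul_smul]⟩, hl⟩⟩

theorem vc_union {Γ X : Type*} [Group Γ] [Countable Γ] [MeasurableSpace X] [MulAction Γ X]
    [MeasurableConstSMul Γ X] (S : ℚ → Set X) (hS : ∀ q, MeasurableSet (S q))
    (hof : ∀ q x, {y | (∃ g : Γ, g • x = y) ∧ y ∈ S q}.Finite) :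
    ∃ S' : Set X, MeasurableSet S' ∧ (∀ x, {y | (∃ g : Γ, g • x = y) ∧ y ∈ S'}.Finite) ∧
      ∀ q, ∀ x ∈ S q, ∃ g : Γ, g • x ∈ S' := by
  classical
  let N : ℚ → ℕ := Encodable.encode
  have hN : Function.Injective N := Encodable.encode_injective
  refine ⟨{x | ∃ q, x ∈ S q ∧ ∀ r, N r < N q → ∀ g : Γ, g • x ∉ S r}, ?_, ?_, ?_⟩
  · have : {x | ∃ q, x ∈ S q ∧ ∀ r, N r < N q → ∀ g : Γ, g • x ∉ S r} =
        ⋃ q, S q ∩ ⋂ r, ⋂ (_ : N r < N q), ⋂ g : Γ, ((fun x => g • x) ⁻¹' (S r))ᶜ := by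
      ext x; simp
    rw [this]
    exact MeasurableSet.iUnion fun q => (hS q).inter (MeasurableSet.iInter fun r =>
      MeasurableSet.iInter fun _ => MeasurableSet.iInter fun g =>
        (measurable_const_smul g (hS r)).compl)
  · intro x
    by_cases hne : ∃ y, (∃ g : Γ, g • x = y) ∧
      y ∈ {x | ∃ q, x ∈ S q ∧ ∀ r, N r < N q → ∀ g : Γ, g • x ∉ S r}
    · obtain ⟨_, ⟨g, rfl⟩, q, hq, hq'⟩ := hne
      refine (hof q x).subset ?_
      rintro _ ⟨⟨k, rfl⟩, r, hr, hr'⟩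
      refine ⟨⟨k, rfl⟩, ?_⟩
      have : q = r := by
        apply hN
        rcases lt_trichotomy (N q) (N r) with h | h | h
        · exact absurd (by simpa [mul_smul] using hq) (hr' q h (g * k⁻¹))
        · exact h
        · exact absurd (by simpa [mul_smul] using hr) (hq' r h (k * g⁻¹))
      rw [this]; exact hr
    · push Not at hne
      convert Set.finite_empty
      rw [Set.eq_empty_iff_forall_notMem]
      rintro y ⟨h1, h2⟩
      exact hne y h1 h2
  · intro q x hx
    have hex : ∃ n, ∃ q, N q = n ∧ ∃ g : Γ, g • x ∈ S q := ⟨N q, q, rfl, 1, by simpa using hx⟩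
    obtain ⟨r, hr, g, hg⟩ := Nat.find_spec hex
    refine ⟨g, r, hg, fun r' hr' k hk => ?_⟩
    exact Nat.find_min hex (hr ▸ hr') ⟨r', rfl, k * g, by rw [mul_smul]; exact hk⟩

theorem vc_code {Γ X : Type*} [Group Γ] [Countable Γ] [MeasurableSpace X] [MulAction Γ X]
    [MeasurableConstSMul Γ X] (f : X → ℝ) (hf : Measurable f) (hfi : Function.Injective f)
    (W : Set X) (hWi : ∀ x ∈ W, ∀ g : Γ, g • x ∈ W)
    (F : X → X → Prop) (hm : ∀ g : Γ, MeasurableSet {x | F x (g • x)})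
    (hrefl : ∀ x, F x x) (hsymm : ∀ x ∈ W, ∀ y, F x y → F y x)
    (htrans : ∀ x ∈ W, ∀ y z, F x y → F y z → F x z)
    (hfin : ∀ x ∈ W, {y | (∃ g : Γ, g • x = y) ∧ F x y}.Finite) :
    ∃ c : X → ℝ, Measurable c ∧ ∀ x ∈ W, ∀ g : Γ, c x = c (g • x) ↔ F x (g • x) := by
  classical
  refine ⟨fun x => ⨅ g : Γ, if F x (g • x) then f (g • x) else f x, ?_, ?_⟩
  · exact Measurable.iInf fun g => Measurable.ite (hm g) (hf.comp (measurable_const_smul g)) hf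
  let C : X → Set X := fun x => {y | (∃ g : Γ, g • x = y) ∧ F x y}
  have hcC : ∀ x, (⨅ g : Γ, if F x (g • x) then f (g • x) else f x) = sInf (f '' C x) := by
    intro x
    rw [iInf]
    congr 1
    ext t
    constructor
    · rintro ⟨g, rfl⟩
      simp only
      split_ifs with h
      · exact ⟨_, ⟨⟨g, rfl⟩, h⟩, rfl⟩
      · exact ⟨_, ⟨⟨1, one_smul _ _⟩, hrefl x⟩, rfl⟩
    · rintro ⟨_, ⟨⟨g, rfl⟩, h⟩, rfl⟩
      exact ⟨g, by simp [h]⟩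
  have hmem : ∀ x ∈ W, ∃ y ∈ C x, f y = sInf (f '' C x) := by
    intro x hx
    have hne : (f '' C x).Nonempty := ⟨f x, x, ⟨⟨1, one_smul _ _⟩, hrefl x⟩, rfl⟩
    exact hne.csInf_mem ((hfin x hx).image f)
  intro x hx g
  simp only [hcC]
  constructor
  · intro h
    obtain ⟨y, hy, hy'⟩ := hmem x hx
    obtain ⟨z, hz, hz'⟩ := hmem (g • x) (hWi x hx g)
    have : y = z := hfi (by rw [hy', hz', h])
    subst this
    exact htrans x hx _ _ hy.2 (hsymm _ (hWi x hx g) _ hz.2)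
  · intro h
    have : C x = C (g • x) := by
      ext y
      constructor
      · rintro ⟨⟨k, rfl⟩, hk⟩
        exact ⟨⟨k * g⁻¹, by simp [mul_smul]⟩, htrans _ (hWi x hx g) _ _ (hsymm _ hx _ h) hk⟩
      · rintro ⟨⟨k, rfl⟩, hk⟩
        exact ⟨⟨k * g, by simp [mul_smul]⟩, htrans _ hx _ _ h hk⟩
    rw [this]

theorem vc_main {Γ X : Type*} [Group Γ] [Countable Γ] [MeasurableSpace X] [MulAction Γ X]
    [MeasurableConstSMul Γ X] (f : X → ℝ) (hf : Measurable f) (hfi : Function.Injective f)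
    (hfpos : ∀ x, 0 ≤ f x) (w e : Γ → ℤ) (he : ∀ g, e g = 1 ∨ e g = -1)
    (hw : ∀ d g, w (d * g) = w g + e g * w d) (hwf : ∀ R : ℤ, {g : Γ | |w g| ≤ R}.Finite) :
    VCGood Γ (Set.univ : Set X) := by
  classical
  have hfg : ∀ g : Γ, Measurable fun x => f (g • x) := fun g => hf.comp (measurable_const_smul g)
  have hw1 : w 1 = 0 := by
    have := hw 1 1
    rw [mul_one] at this
    rcases he 1 with h | h <;> rw [h] at this <;> linarith
  have hwinv : ∀ g, w g + e g * w g⁻¹ = 0 := by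
    intro g; rw [← hw, inv_mul_cancel, hw1]
  -- extreme points of sublevel sets
  let Sq : ℚ → Set X := fun q => {x | f x < q ∧
    ((∀ d : Γ, f (d • x) < q → 0 ≤ w d) ∨ (∀ d : Γ, f (d • x) < q → w d ≤ 0))}
  have hSqm : ∀ q, MeasurableSet (Sq q) := by
    intro q
    have hB : ∀ d : Γ, MeasurableSet {x | f (d • x) < q} := fun d =>
      measurableSet_lt (hfg d) measurable_const
    have : Sq q = {x | f x < q} ∩ ((⋂ d : Γ, ⋂ (_ : ¬ 0 ≤ w d), {x | f (d • x) < q}ᶜ) ∪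
        (⋂ d : Γ, ⋂ (_ : ¬ w d ≤ 0), {x | f (d • x) < q}ᶜ)) := by
      ext x
      simp only [Sq, Set.mem_ofPred_eq, Set.mem_inter_iff, Set.mem_iInter, Set.mem_union,
        Set.mem_compl_iff]
      simp only [not_imp_not]
    rw [this]
    refine (measurableSet_lt hf measurable_const).inter (MeasurableSet.union ?_ ?_)
    · exact MeasurableSet.iInter fun d => MeasurableSet.iInter fun _ => (hB d).compl
    · exact MeasurableSet.iInter fun d => MeasurableSet.iInter fun _ => (hB d).compl
  have hSqf : ∀ q x, {y | (∃ g : Γ, g • x = y) ∧ y ∈ Sq q}.Finite := by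
    intro q x
    by_cases hne : ∃ g : Γ, g • x ∈ Sq q
    swap
    · convert Set.finite_empty
      rw [Set.eq_empty_iff_forall_notMem]
      rintro y ⟨⟨g, rfl⟩, h2⟩
      exact hne ⟨g, h2⟩
    obtain ⟨g, hg⟩ := hne
    -- heights relative to y
    set y := g • x with hy
    suffices h : ∃ R : ℤ, ∀ d : Γ, d • y ∈ Sq q → |w d| ≤ R by
      obtain ⟨R, hR⟩ := h
      refine ((hwf R).image (fun d => d • y)).subset ?_
      rintro _ ⟨⟨k, rfl⟩, hk⟩
      have : (k * g⁻¹) • y = k • x := by simp [hy, mul_smul]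
      exact ⟨k * g⁻¹, hR _ (by rw [this]; exact hk), this⟩
    by_cases hone : ∃ d : Γ, d • y ∈ Sq q ∧ w d ≠ 0
    swap
    · push Not at hone
      exact ⟨0, fun d hd => by rw [hone d hd]; simp⟩
    obtain ⟨d, hd, hd0⟩ := hone
    refine ⟨|w d|, fun k hk => ?_⟩
    have hyq : f y < q := hg.1
    have a1 : (0 ≤ w d ∧ 0 ≤ w k) ∨ (w d ≤ 0 ∧ w k ≤ 0) := by
      rcases hg.2 with h | h
      · exact Or.inl ⟨h d hd.1, h k hk.1⟩
      · exact Or.inr ⟨h d hd.1, h k hk.1⟩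
    have b1 := hw (k * d⁻¹) d
    have b2 := hwinv d
    rw [inv_mul_cancel_right] at b1
    have hd2 := hd.2
    have b3 : (0 ≤ w d⁻¹ ∧ 0 ≤ w (k * d⁻¹)) ∨ (w d⁻¹ ≤ 0 ∧ w (k * d⁻¹) ≤ 0) := by
      rcases hd2 with h | h
      · exact Or.inl ⟨h d⁻¹ (by simpa using hyq), h (k * d⁻¹) (by simpa [mul_smul] using hk.1)⟩
      · exact Or.inr ⟨h d⁻¹ (by simpa using hyq), h (k * d⁻¹) (by simpa [mul_smul] using hk.1)⟩
    rcases he d with h | h <;> rw [h] at b1 b2 <;> rcases a1 with a | a <;>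
      [rw [abs_of_nonneg a.1, abs_of_nonneg a.2]; rw [abs_of_nonpos a.1, abs_of_nonpos a.2];
       rw [abs_of_nonneg a.1, abs_of_nonneg a.2]; rw [abs_of_nonpos a.1, abs_of_nonpos a.2]] <;>
      omega
  obtain ⟨SQ, hSQm, hSQf, hSQ⟩ := vc_union (Γ := Γ) Sq hSqm hSqf
  let S0 : Set X := {x | ∀ g : Γ, f x ≤ f (g • x)}
  have hS0m : MeasurableSet S0 := by
    have : S0 = ⋂ g : Γ, {x | f x ≤ f (g • x)} := by ext; simp [S0]
    rw [this]
    exact MeasurableSet.iInter fun g => measurableSet_le hf (hfg g)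
  have hS0f : ∀ x, {y | (∃ g : Γ, g • x = y) ∧ y ∈ S0}.Finite := by
    intro x
    apply Set.Subsingleton.finite
    rintro _ ⟨⟨g, rfl⟩, hg⟩ _ ⟨⟨k, rfl⟩, hk⟩
    apply hfi
    have h1 := hg (k * g⁻¹)
    have h2 := hk (g * k⁻¹)
    simp only [mul_smul, inv_smul_smul] at h1 h2
    exact le_antisymm h1 h2
  let W : Set X := {x | ∀ g : Γ, g • x ∉ SQ ∪ S0}
  have hWi : ∀ x ∈ W, ∀ g : Γ, g • x ∈ W := by
    intro x hx g k
    rw [← mul_smul]; exact hx _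
  have hWm : MeasurableSet W := by
    have : W = ⋂ g : Γ, ((fun x => g • x) ⁻¹' (SQ ∪ S0))ᶜ := by ext; simp [W]
    rw [this]
    exact MeasurableSet.iInter fun g => (measurable_const_smul g (hSQm.union hS0m)).compl
  have hWq : ∀ x ∈ W, ∀ q, ∀ g : Γ, g • x ∉ Sq q := by
    intro x hx q g hg
    obtain ⟨k, hk⟩ := hSQ q _ hg
    exact hWi x hx g k (Or.inl hk)
  -- markers
  let A : ℕ → Set X := fun n => {x | ∀ g : Γ, f x ≤ f (g • x) + 1 / ((n : ℝ) + 1)}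
  have hAm : ∀ n, MeasurableSet (A n) := by
    intro n
    have : A n = ⋂ g : Γ, {x | f x ≤ f (g • x) + 1 / ((n : ℝ) + 1)} := by ext; simp [A]
    rw [this]
    exact MeasurableSet.iInter fun g => measurableSet_le hf ((hfg g).add measurable_const)
  have hAanti : ∀ n m, n ≤ m → A m ⊆ A n := by
    intro n m hnm x hx g
    have := one_div_le_one_div_of_le (by positivity : (0:ℝ) < (n : ℝ) + 1)
      (by exact_mod_cast Nat.succ_le_succ hnm : (n : ℝ) + 1 ≤ (m : ℝ) + 1)
    linarith [hx g]
  have hAvan : ∀ x, x ∉ S0 → ∃ n, x ∉ A n := by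
    intro x hx
    simp only [S0, Set.mem_ofPred_eq, not_forall, not_le] at hx
    obtain ⟨g, hg⟩ := hx
    obtain ⟨n, hn⟩ := exists_nat_one_div_lt (sub_pos.2 hg)
    refine ⟨n, fun h => ?_⟩
    have := h g
    linarith
  have hAunb : ∀ x ∈ W, ∀ n, (∃ d : Γ, d • x ∈ A n ∧ 0 < w d) ∧ (∃ d : Γ, d • x ∈ A n ∧ w d < 0) := by
    intro x hx n
    have hbdd : BddBelow (Set.range fun g : Γ => f (g • x)) := ⟨0, by
      rintro _ ⟨g, rfl⟩; exact hfpos _⟩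
    set i := ⨅ g : Γ, f (g • x) with hi
    have hile : ∀ g : Γ, i ≤ f (g • x) := fun g => ciInf_le hbdd g
    obtain ⟨q, hq1, hq2⟩ := exists_rat_btwn
      (show i < i + 1 / ((n : ℝ) + 1) from lt_add_of_pos_right _ (by positivity))
    obtain ⟨g0, hg0⟩ := exists_lt_of_ciInf_lt hq1
    have hBA : ∀ d : Γ, f (d • x) < q → d • x ∈ A n := by
      intro d hd g
      have := hile (g * d)
      rw [mul_smul] at this
      linarith
    constructor
    · by_contra hcon
      push Not at hcon
      obtain ⟨u, ⟨d0, hd0, rfl⟩, hmax⟩ := Int.exists_greatest_of_bdd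
        (P := fun z => ∃ d : Γ, f (d • x) < q ∧ w d = z)
        ⟨0, by rintro z ⟨d, hd, rfl⟩; exact hcon d (hBA d hd)⟩ ⟨_, g0, hg0, rfl⟩
      have hm : ∀ d : Γ, f (d • d0 • x) < q → e d0 * w d ≤ 0 := by
        intro d hd
        have := hmax _ ⟨d * d0, by rw [mul_smul]; exact hd, rfl⟩
        rw [hw] at this
        linarith
      refine hWq x hx q d0 ⟨hd0, ?_⟩
      rcases he d0 with h | h <;> rw [h] at hm
      · right; intro d hd; linarith [hm d hd]
      · left; intro d hd; linarith [hm d hd]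
    · by_contra hcon
      push Not at hcon
      obtain ⟨u, ⟨d0, hd0, rfl⟩, hmin⟩ := Int.exists_least_of_bdd
        (P := fun z => ∃ d : Γ, f (d • x) < q ∧ w d = z)
        ⟨0, by rintro z ⟨d, hd, rfl⟩; exact hcon d (hBA d hd)⟩ ⟨_, g0, hg0, rfl⟩
      have hm : ∀ d : Γ, f (d • d0 • x) < q → 0 ≤ e d0 * w d := by
        intro d hd
        have := hmin _ ⟨d * d0, by rw [mul_smul]; exact hd, rfl⟩
        rw [hw] at this
        linarith
      refine hWq x hx q d0 ⟨hd0, ?_⟩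
      rcases he d0 with h | h <;> rw [h] at hm
      · left; intro d hd; linarith [hm d hd]
      · right; intro d hd; linarith [hm d hd]
  -- finite equivalence relations
  let F : ℕ → X → X → Prop := fun n x y => x = y ∨ (n ≠ 0 ∧ ∃ g : Γ, g • x = y ∧
    ∀ d : Γ, ((0 ≤ w d ∧ w d ≤ w g) ∨ (w g ≤ w d ∧ w d ≤ 0)) → d • x ∉ A n)
  have heqm : ∀ g k : Γ, MeasurableSet {x : X | g • x = k • x} := by
    intro g k
    have : {x : X | g • x = k • x} = {x : X | f (g • x) = f (k • x)} := by
      ext x; exact hfi.eq_iff.symm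
    rw [this]
    exact measurableSet_eq_fun (hfg g) (hfg k)
  have hFm : ∀ n (g : Γ), MeasurableSet {x | F n x (g • x)} := by
    intro n g
    have : {x | F n x (g • x)} = {x : X | (1 : Γ) • x = g • x} ∪ ⋃ (_ : n ≠ 0), ⋃ k : Γ,
        {x : X | k • x = g • x} ∩
        ⋂ d : Γ, ⋂ (_ : (0 ≤ w d ∧ w d ≤ w k) ∨ (w k ≤ w d ∧ w d ≤ 0)),
          ((fun x => d • x) ⁻¹' (A n))ᶜ := by
      ext x
      simp only [F, Set.mem_ofPred_eq, Set.mem_inter_iff, Set.mem_iInter, Set.mem_union,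
        Set.mem_compl_iff, Set.mem_iUnion, Set.mem_preimage, one_smul, exists_prop]
    rw [this]
    refine (heqm 1 g).union (MeasurableSet.iUnion fun _ => MeasurableSet.iUnion fun k =>
      (heqm k g).inter (MeasurableSet.iInter fun d => MeasurableSet.iInter fun _ =>
        (measurable_const_smul d (hAm n)).compl))
  have hFrefl : ∀ n x, F n x x := fun n x => Or.inl rfl
  have hFsymm : ∀ n x y, F n x y → F n y x := by
    rintro n x y (rfl | ⟨hn, g, rfl, hg⟩)
    · exact Or.inl rfl
    · refine Or.inr ⟨hn, g⁻¹, by simp, fun d hd => ?_⟩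
      rw [← mul_smul]
      apply hg
      have b1 := hw d g
      have b2 := hwinv g
      rcases he g with h | h <;> rw [h] at b1 b2 <;> omega
  have hFtrans : ∀ n x y z, F n x y → F n y z → F n x z := by
    rintro n x y z (rfl | ⟨hn, g, rfl, hg⟩) (rfl | ⟨_, k, rfl, hk⟩)
    · exact Or.inl rfl
    · exact Or.inr ⟨by assumption, k, rfl, hk⟩
    · exact Or.inr ⟨hn, g, rfl, hg⟩
    · refine Or.inr ⟨hn, k * g, by rw [mul_smul], fun d hd => ?_⟩
      by_cases h1 : (0 ≤ w d ∧ w d ≤ w g) ∨ (w g ≤ w d ∧ w d ≤ 0)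
      · exact hg d h1
      · have h2 := hk (d * g⁻¹)
        rw [mul_smul, inv_smul_smul] at h2
        apply h2
        have b1 := hw (d * g⁻¹) g
        have b2 := hw k g
        rw [inv_mul_cancel_right] at b1
        rcases he g with h | h <;> rw [h] at b1 b2 <;> omega
  have hFmono : ∀ n x y, F n x y → F (n + 1) x y := by
    rintro n x y (rfl | ⟨hn, g, rfl, hg⟩)
    · exact Or.inl rfl
    · exact Or.inr ⟨by omega, g, rfl, fun d hd h => hg d hd (hAanti n (n + 1) (by omega) h)⟩
  have hFfin : ∀ n, ∀ x ∈ W, {y | (∃ g : Γ, g • x = y) ∧ F n x y}.Finite := by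
    intro n x hx
    obtain ⟨⟨d1, hd1, hp1⟩, ⟨d2, hd2, hp2⟩⟩ := hAunb x hx n
    refine (((hwf (w d1 - w d2)).image (fun g => g • x)).union (Set.finite_singleton x)).subset ?_
    rintro y ⟨_, rfl | ⟨hn, g, rfl, hg⟩⟩
    · right; rfl
    · left
      refine ⟨g, ?_, rfl⟩
      have c1 : ¬ (w d1 ≤ w g) := fun h => hg d1 (Or.inl ⟨hp1.le, h⟩) hd1
      have c2 : ¬ (w g ≤ w d2) := fun h => hg d2 (Or.inr ⟨h, hp2.le⟩) hd2
      simp only [Set.mem_ofPred_eq]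
      rw [abs_le]; omega
  have hFall : ∀ x ∈ W, ∀ g : Γ, ∃ n, F n x (g • x) := by
    intro x hx g
    have hI : {d : Γ | (0 ≤ w d ∧ w d ≤ w g) ∨ (w g ≤ w d ∧ w d ≤ 0)}.Finite := by
      refine (hwf |w g|).subset ?_
      intro d hd
      simp only [Set.mem_ofPred_eq] at hd ⊢
      rcases hd with h | h
      · exact abs_le_abs_of_nonneg h.1 h.2
      · exact abs_le_abs_of_nonpos h.2 h.1
    have hev : ∀ᶠ n in Filter.atTop,
        ∀ d ∈ {d : Γ | (0 ≤ w d ∧ w d ≤ w g) ∨ (w g ≤ w d ∧ w d ≤ 0)}, d • x ∉ A n := by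
      rw [Filter.eventually_all_finite hI]
      intro d _
      obtain ⟨n, hn⟩ := hAvan (d • x) (fun h => hx d (Or.inr h))
      filter_upwards [Filter.eventually_ge_atTop n] with m hm h
      exact hn (hAanti n m hm h)
    obtain ⟨n, hn, hn0⟩ := (hev.and (Filter.eventually_ge_atTop 1)).exists
    exact ⟨n, Or.inr ⟨by omega, g, rfl, hn⟩⟩
  choose c hcm hc using fun n => vc_code (Γ := Γ) f hf hfi W hWi (F n) (hFm n) (hFrefl n)
    (fun x _ y => hFsymm n x y) (fun x _ y z => hFtrans n x y z) (hFfin n)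
  have hc' : ∀ n, ∀ x ∈ W, ∀ g k : Γ, c n (g • x) = c n (k • x) ↔ F n (g • x) (k • x) := by
    intro n x hx g k
    have := hc n (g • x) (hWi x hx g) (k * g⁻¹)
    simpa [mul_smul] using this
  have hltm : ∀ (g k : Γ), MeasurableSet {x : X | vclt c (g • x) (k • x)} := by
    intro g k
    have : {x : X | vclt c (g • x) (k • x)} = ⋃ n : ℕ,
        {x : X | c n (g • x) < c n (k • x)} ∩ {x : X | c (n + 1) (g • x) = c (n + 1) (k • x)} := by
      ext x; simp [vclt]
    rw [this]
    have hcg : ∀ n (g : Γ), Measurable fun x => c n (g • x) := fun n g =>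
      (hcm n).comp (measurable_const_smul g)
    exact MeasurableSet.iUnion fun n => (measurableSet_lt (hcg _ _) (hcg _ _)).inter
      (measurableSet_eq_fun (hcg _ _) (hcg _ _))
  have htri : ∀ x ∈ W, ∀ g k : Γ, g • x = k • x ∨ vclt c (g • x) (k • x) ∨ vclt c (k • x) (g • x) := by
    intro x hx g k
    obtain ⟨_, _, h3, _⟩ := vclt_facts (fun n (a : Set.range fun a : Γ => a • x) => c n a.1)
      (by
        rintro n ⟨_, a, rfl⟩ ⟨_, b, rfl⟩ h
        simp only at h ⊢
        rw [hc' _ x hx] at h ⊢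
        exact hFmono _ _ _ h)
      (by
        rintro ⟨_, a, rfl⟩ ⟨_, b, rfl⟩
        obtain ⟨n, hn⟩ := hFall (a • x) (hWi x hx a) (b * a⁻¹)
        refine ⟨n, ?_⟩
        simp only
        rw [hc' _ x hx]
        simpa [mul_smul] using hn)
      (by
        rintro ⟨_, a, rfl⟩ ⟨_, b, rfl⟩ h
        simp only at h
        rw [hc' _ x hx] at h
        rcases h with h | h
        · exact Subtype.ext h
        · exact absurd rfl h.1)
    rcases h3 ⟨g • x, g, rfl⟩ ⟨k • x, k, rfl⟩ with h | h | h
    · exact Or.inl (congrArg Subtype.val h)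
    · exact Or.inr (Or.inl h)
    · exact Or.inr (Or.inr h)
  -- extreme points of the order
  let M1 : Set X := {x | x ∈ W ∧ ∀ g : Γ, ¬ vclt c x (g • x)}
  let M2 : Set X := {x | x ∈ W ∧ ∀ g : Γ, ¬ vclt c (g • x) x}
  have hM1m : MeasurableSet M1 := by
    have : M1 = W ∩ ⋂ g : Γ, {x | vclt c ((1 : Γ) • x) (g • x)}ᶜ := by ext; simp [M1]
    rw [this]
    exact hWm.inter (MeasurableSet.iInter fun g => (hltm 1 g).compl)
  have hM2m : MeasurableSet M2 := by
    have : M2 = W ∩ ⋂ g : Γ, {x | vclt c (g • x) ((1 : Γ) • x)}ᶜ := by ext; simp [M2]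
    rw [this]
    exact hWm.inter (MeasurableSet.iInter fun g => (hltm g 1).compl)
  have hWback : ∀ x, ∀ g : Γ, g • x ∈ W → x ∈ W := by
    intro x g h
    have := hWi _ h g⁻¹
    rwa [inv_smul_smul] at this
  have hM1f : ∀ x, {y | (∃ g : Γ, g • x = y) ∧ y ∈ M1}.Finite := by
    intro x
    apply Set.Subsingleton.finite
    rintro _ ⟨⟨g, rfl⟩, hg⟩ _ ⟨⟨k, rfl⟩, hk⟩
    have h1 := hg.2 (k * g⁻¹)
    have h2 := hk.2 (g * k⁻¹)
    simp only [mul_smul, inv_smul_smul] at h1 h2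
    rcases htri x (hWback x g hg.1) g k with h | h | h
    · exact h
    · exact absurd h h1
    · exact absurd h h2
  have hM2f : ∀ x, {y | (∃ g : Γ, g • x = y) ∧ y ∈ M2}.Finite := by
    intro x
    apply Set.Subsingleton.finite
    rintro _ ⟨⟨g, rfl⟩, hg⟩ _ ⟨⟨k, rfl⟩, hk⟩
    have h1 := hg.2 (k * g⁻¹)
    have h2 := hk.2 (g * k⁻¹)
    simp only [mul_smul, inv_smul_smul] at h1 h2
    rcases htri x (hWback x g hg.1) g k with h | h | h
    · exact h
    · exact absurd h h2
    · exact absurd h h1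
  let S : Set X := (SQ ∪ S0) ∪ (M1 ∪ M2)
  have hSm : MeasurableSet S := (hSQm.union hS0m).union (hM1m.union hM2m)
  have hSf : ∀ x, {y | (∃ g : Γ, g • x = y) ∧ y ∈ S}.Finite := by
    intro x
    refine (((hSQf x).union (hS0f x)).union ((hM1f x).union (hM2f x))).subset ?_
    rintro y ⟨h, (h1 | h1) | (h1 | h1)⟩
    · exact Or.inl (Or.inl ⟨h, h1⟩)
    · exact Or.inl (Or.inr ⟨h, h1⟩)
    · exact Or.inr (Or.inl ⟨h, h1⟩)
    · exact Or.inr (Or.inr ⟨h, h1⟩)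
  obtain ⟨S', hS'm, hS'sel, hS'⟩ := vc_select (Γ := Γ) f hf hfi S hSm hSf
  let D : Set X := {x | ∃ g : Γ, g • x ∈ S'}
  have hDm : MeasurableSet D := by
    have : D = ⋃ g : Γ, (fun x => g • x) ⁻¹' S' := by ext; simp [D]
    rw [this]
    exact MeasurableSet.iUnion fun g => measurable_const_smul g hS'm
  have hDi : ∀ (g : Γ) x, g • x ∈ D ↔ x ∈ D := by
    intro g x
    constructor
    · rintro ⟨k, hk⟩; exact ⟨k * g, by rw [mul_smul]; exact hk⟩
    · rintro ⟨k, hk⟩; exact ⟨k * g⁻¹, by rw [mul_smul, inv_smul_smul]; exact hk⟩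
  have hDS : ∀ x ∈ Dᶜ, ∀ g : Γ, g • x ∉ S := by
    intro x hx g hg
    exact hx ((hS' x).2 ⟨g, hg⟩)
  have hDW : ∀ x ∈ Dᶜ, x ∈ W := fun x hx g hg => hDS x hx g (Or.inl hg)
  refine vc_glue (Γ := Γ) Set.univ D hDm hDi ?_ ?_
  · rw [Set.inter_univ]
    exact vc_smooth S' hS'm hS'sel
  · rw [Set.inter_univ]
    refine vc_zeta c hcm Dᶜ ?_ ?_ ?_ ?_ ?_ ?_ ?_
    · intro x hx g h
      exact hx ((hDi g x).1 h)
    · intro n x hx g h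
      rw [hc _ x (hDW x hx)] at h ⊢
      exact hFmono _ _ _ h
    · intro x hx g
      obtain ⟨n, hn⟩ := hFall x (hDW x hx) g
      exact ⟨n, (hc _ x (hDW x hx) g).2 hn⟩
    · intro x hx g h
      rw [hc _ x (hDW x hx)] at h
      rcases h with h | h
      · exact h
      · exact absurd rfl h.1
    · intro n x hx
      refine (hFfin n x (hDW x hx)).subset ?_
      rintro _ ⟨⟨g, rfl⟩, h⟩
      exact ⟨⟨g, rfl⟩, (hc _ x (hDW x hx) g).1 h.symm⟩
    · intro x hx
      by_contra hcon
      push Not at hcon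
      exact hDS x hx 1 (by rw [one_smul]; exact Or.inr (Or.inl ⟨hDW x hx, hcon⟩))
    · intro x hx
      by_contra hcon
      push Not at hcon
      exact hDS x hx 1 (by rw [one_smul]; exact Or.inr (Or.inr ⟨hDW x hx, hcon⟩))


/-- Every Borel action of a virtually infinite cyclic group `Γ` (a group
with a finite index subgroup isomorphic to `ℤ`) on a standard Borel space `X` is
hyperfinite: there is a Borel action of `ℤ` on `X` (generated by a single Borel
automorphism `T`) whose orbit equivalence relation coincides with that of the
`Γ`-action. -/
theorem virtually_cyclic_borel_action_hyperfinite {Γ : Type*} [Group Γ] [Countable Γ]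
    (hvc : ∃ H : Subgroup Γ, H.FiniteIndex ∧ Nonempty (H ≃* Multiplicative ℤ))
    {X : Type*} [MeasurableSpace X] [StandardBorelSpace X]
    [MulAction Γ X] (hBorel : ∀ g : Γ, Measurable fun x : X => g • x) :
    ∃ T : X ≃ X, Measurable (⇑T) ∧ Measurable (⇑T.symm) ∧
      ∀ x y : X, (∃ g : Γ, g • x = y) ↔ (∃ n : ℤ, (T ^ n) x = y) := by
  have : MeasurableConstSMul Γ X := ⟨hBorel⟩
  obtain ⟨w, e, he, hw, hwf⟩ := vc_height hvc
  obtain ⟨f, hf⟩ := MeasureTheory.exists_measurableEmbedding_real X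
  exact vc_final (vc_main (fun x => Real.exp (f x)) (Real.measurable_exp.comp hf.measurable)
    (Real.exp_injective.comp hf.injective) (fun x => (Real.exp_pos _).le) w e he hw hwf)
end

section
/- Fix k ≥ 3. Let Γ_k = (ℤ/kℤ) × ℤ and Δ_k = (ℤ/kℤ) ⋊_φ ℤ (φ sending 1 to inversion), acting on F(2^{Γ_k}) and F(2^{Δ_k}) respectively by the left shift. Then there is a Borel bijection f : F(2^{Γ_k}) → F(2^{Δ_k}) such that x and y lie in the same Γ_k-orbit if and only if f(x) and f(y) lie in the same Δ_k-orbit; i.e. the orbit equivalence relations of the two shift actions are Borel isomorphic. -/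
open Multiplicative

section Defs

variable {G : Type*} [Group G]

/-- The left shift action of `g : G` on `x : G → Bool` (`2^G` with `2 = Bool`):
`(g · x)(h) = x (g⁻¹ h)`. -/
def shiftMap (g : G) (x : G → Bool) : G → Bool := fun h => x (g⁻¹ * h)

/-- The free part `F(2^G)` of the left shift action. -/
def FreePart (G : Type*) [Group G] : Set (G → Bool) :=
  {x | ∀ g : G, g ≠ 1 → shiftMap g x ≠ x}

/-- Adjacency in the shift graph of the marked group `(G, S)`: distinct `x, y ∈ F(2^G)`
are adjacent iff `y = s · x` for some `s ∈ S`. -/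
def ShiftAdj (S : Set G) (x y : FreePart G) : Prop :=
  x ≠ y ∧ ∃ s ∈ S, (y : G → Bool) = shiftMap s (x : G → Bool)

/-- Adjacency in the Cayley graph of `(G, S)`: distinct `g, h` are adjacent iff
`h = s * g` for some `s ∈ S`. -/
def CayleyAdj (S : Set G) (g h : G) : Prop :=
  g ≠ h ∧ ∃ s ∈ S, h = s * g

/-- `(G, S)` is a marked group: `S` is a finite symmetric generating set
not containing the identity. -/
def IsMarkedGroup (S : Set G) : Prop :=
  S.Finite ∧ (∀ s ∈ S, s⁻¹ ∈ S) ∧ (1 : G) ∉ S ∧ Subgroup.closure S = ⊤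

end Defs

/-- A graph (given by its adjacency relation) has an `n`-coloring. -/
def HasColoring {X : Type*} (Adj : X → X → Prop) (n : ℕ) : Prop :=
  ∃ c : X → Fin n, ∀ x y, Adj x y → c x ≠ c y

/-- The chromatic number: the least `n` admitting an `n`-coloring. -/
noncomputable def chromatic {X : Type*} (Adj : X → X → Prop) : ℕ :=
  sInf {n | HasColoring Adj n}

/-- A graph on a measurable space has a Borel `n`-coloring. -/
def HasBorelColoring {X : Type*} [MeasurableSpace X] (Adj : X → X → Prop) (n : ℕ) : Prop :=
  ∃ c : X → Fin n, Measurable c ∧ ∀ x y, Adj x y → c x ≠ c y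

/-- The Borel chromatic number: the least `n` admitting a Borel `n`-coloring. -/
noncomputable def borelChromatic {X : Type*} [MeasurableSpace X] (Adj : X → X → Prop) : ℕ :=
  sInf {n | HasBorelColoring Adj n}
/-- The group `Γ_k = ℤ/kℤ × ℤ` (written multiplicatively). -/
abbrev GammaK (k : ℕ) : Type := Multiplicative (ZMod k × ℤ)

/-- The homomorphism `ℤ → Aut(ℤ/kℤ)` (written multiplicatively) sending `1` to the
inversion automorphism `i ↦ -i`. -/
def phiK (k : ℕ) : Multiplicative ℤ →* MulAut (Multiplicative (ZMod k)) :=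
  zpowersHom (MulAut (Multiplicative (ZMod k))) (MulEquiv.inv (Multiplicative (ZMod k)))

/-- The group `Δ_k = ℤ/kℤ ⋊_φ ℤ`, `φ` sending `1` to inversion. -/
abbrev DeltaK (k : ℕ) : Type :=
  SemidirectProduct (Multiplicative (ZMod k)) (Multiplicative ℤ) (phiK k)

section Aux
open Finset

theorem zk_idem (k : ℕ) (hk : k ≠ 0) : ∃ (ι : Type) (_ : Fintype ι) (e z : ι → ZMod k),
    (∀ i, e i * e i = e i) ∧ (∀ i j, i ≠ j → e i * e j = 0) ∧ (∑ i, e i = 1) ∧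
    (∀ i, z i ≠ 0) ∧ ∀ i v, e i * v ≠ 0 → ∃ r, r * v = z i := by
  classical
  let ι := {p // p ∈ k.primeFactors}
  let a : ι → ℕ := fun p => p.1 ^ (k.factorization p.1)
  have hprod : ∏ i, a i = k := by
    have := Nat.prod_factorization_pow_eq_self hk
    rw [Finsupp.prod, Nat.support_factorization] at this
    rw [← Finset.prod_coe_sort] at this
    exact this
  have hcop : Pairwise (Function.onFun Nat.Coprime a) := by
    intro i j hij
    have hi := Nat.prime_of_mem_primeFactors i.2
    have hj := Nat.prime_of_mem_primeFactors j.2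
    exact Nat.Coprime.pow _ _ ((Nat.coprime_primes hi hj).2 fun h => hij (Subtype.ext h))
  have key : ∀ i (w : ZMod (a i)), w ≠ 0 → ∃ r, r * w = ((i.1 ^ (k.factorization i.1 - 1) : ℕ) : ZMod (a i)) := by
    intro i w hw
    have hi := Nat.prime_of_mem_primeFactors i.2
    have : NeZero (a i) := ⟨(pow_pos hi.pos _).ne'⟩
    obtain ⟨j, hj, hg⟩ := (Nat.dvd_prime_pow hi).1 (Nat.gcd_dvd_right w.val (a i))
    have hjl : j ≠ k.factorization i.1 := by
      intro h
      subst h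
      have h1 : a i ∣ w.val := by
        have := Nat.gcd_dvd_left w.val (a i)
        rw [hg] at this; exact this
      apply hw
      rw [← ZMod.natCast_zmod_val w]
      exact (ZMod.natCast_eq_zero_iff _ _).2 h1
    have hb := Nat.gcd_eq_gcd_ab w.val (a i)
    rw [hg] at hb
    have hb2 := congrArg (Int.cast : ℤ → ZMod (a i)) hb
    push_cast at hb2
    rw [ZMod.natCast_self, zero_mul, add_zero, ZMod.natCast_zmod_val] at hb2
    refine ⟨(Nat.gcdA w.val (a i) : ZMod (a i)) * (i.1 : ZMod (a i)) ^ (k.factorization i.1 - 1 - j), ?_⟩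
    have : k.factorization i.1 - 1 = j + (k.factorization i.1 - 1 - j) := by omega
    rw [mul_right_comm, mul_comm (Int.cast _) w, ← hb2, ← pow_add, ← this]
    push_cast; rfl
  have key0 : ∀ i : ι, ((i.1 ^ (k.factorization i.1 - 1) : ℕ) : ZMod (a i)) ≠ 0 := by
    intro i h
    have hi := Nat.prime_of_mem_primeFactors i.2
    have h1 := (ZMod.natCast_eq_zero_iff _ _).1 h
    have h2 := (Nat.pow_dvd_pow_iff_le_right hi.one_lt).1 h1
    have h3 := hi.factorization_pos_of_dvd hk (Nat.dvd_of_mem_primeFactors i.2)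
    omega
  have Φ' := ZMod.prodEquivPi a hcop
  rw [hprod] at Φ'
  obtain ⟨Φ, -⟩ : ∃ Φ : ZMod k ≃+* ∀ i, ZMod (a i), True := ⟨Φ', trivial⟩
  refine ⟨ι, inferInstance, fun i => Φ.symm (Pi.single i 1),
    fun i => Φ.symm (Pi.single i ((i.1 ^ (k.factorization i.1 - 1) : ℕ) : ZMod (a i))), ?_, ?_, ?_, ?_, ?_⟩
  · intro i
    rw [← map_mul, ← Pi.single_mul, one_mul]
  · intro i j hij
    rw [← map_mul]
    convert map_zero Φ.symm
    ext l
    by_cases h : l = i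
    · subst h; simp [hij]
    · simp [h]
  · rw [← map_sum]
    convert map_one Φ.symm
    exact Finset.univ_sum_single (1 : ∀ i, ZMod (a i))
  · intro i h
    rw [map_eq_zero_iff _ Φ.symm.injective, Pi.single_eq_zero_iff] at h
    exact key0 i h
  · intro i v hv
    have hw : Φ v i ≠ 0 := by
      intro h
      apply hv
      apply Φ.injective
      rw [map_mul, map_zero, Φ.apply_symm_apply]
      ext l
      by_cases hl : l = i
      · subst hl; simp [h]
      · simp [hl]
    obtain ⟨r, hr⟩ := key i _ hw
    refine ⟨Φ.symm (Pi.single i r), ?_⟩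
    apply Φ.injective
    rw [map_mul, Φ.apply_symm_apply, Φ.apply_symm_apply]
    ext l
    by_cases hl : l = i
    · subst hl; simpa using hr
    · simp [hl]

end Aux
section Core

/-- nonnegative integers go to even numbers, negative ones to odd numbers -/
def nkey (i : ℤ) : ℕ := if 0 ≤ i then (2 * i).toNat else (-2 * i - 1).toNat

def IsNear (M : ℤ → Prop) (n m : ℤ) : Prop := M m ∧ ∀ l, M l → nkey (m - n) ≤ nkey (l - n)

theorem IsNear.unique {M : ℤ → Prop} {n m m' : ℤ} (h : IsNear M n m) (h' : IsNear M n m') :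
    m = m' := by
  have h1 := h.2 _ h'.1
  have h2 := h'.2 _ h.1
  unfold nkey at h1 h2
  split_ifs at h1 h2 <;> omega

theorem exists_near {M : ℤ → Prop} (hM : ∃ m, M m) (n : ℤ) : ∃ m, IsNear M n m := by
  classical
  have hex : ∃ t, ∃ m, M m ∧ nkey (m - n) = t := by
    obtain ⟨m, hm⟩ := hM
    exact ⟨_, m, hm, rfl⟩
  obtain ⟨m, hm, ht⟩ := Nat.find_spec hex
  refine ⟨m, hm, fun l hl => ?_⟩
  rw [ht]
  exact Nat.find_min' hex ⟨l, hl, rfl⟩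

theorem IsNear.self {M : ℤ → Prop} {n : ℤ} (h : M n) : IsNear M n n :=
  ⟨h, fun l _ => by simp [nkey]⟩

theorem IsNear.shift {M : ℤ → Prop} {n m t : ℤ} (h : IsNear M n m) :
    IsNear (fun j => M (j - t)) (n + t) (m + t) := by
  refine ⟨by simpa using h.1, fun l hl => ?_⟩
  have := h.2 _ hl
  rwa [show m + t - (n + t) = m - n by ring, show l - (n + t) = l - t - n by ring]

theorem IsNear.step_left {M : ℤ → Prop} {n m : ℤ} (h : IsNear M n m) (hlt : m < n) :
    IsNear M (n - 1) m := by
  refine ⟨h.1, fun l hl => ?_⟩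
  have := h.2 l hl
  unfold nkey at this ⊢
  split_ifs at this ⊢ <;> omega

theorem IsNear.step_right {M : ℤ → Prop} {n m : ℤ} (h : IsNear M n m) (hlt : n < m) :
    IsNear M (n + 1) m := by
  refine ⟨h.1, fun l hl => ?_⟩
  have := h.2 l hl
  unfold nkey at this ⊢
  split_ifs at this ⊢ <;> omega

open Classical in
noncomputable def near (M : ℤ → Prop) (n : ℤ) : ℤ :=
  if h : ∃ m, IsNear M n m then h.choose else n

theorem near_spec {M : ℤ → Prop} (hM : ∃ m, M m) (n : ℤ) : IsNear M n (near M n) := by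
  have h := exists_near hM n
  rw [near, dif_pos h]
  exact h.choose_spec

theorem near_eq {M : ℤ → Prop} {n m : ℤ} (h : IsNear M n m) : near M n = m :=
  (near_spec ⟨m, h.1⟩ n).unique h

/-- If `g` is constant along steps where the nearest point does not change, then `g` at `n`
agrees with `g` at the nearest point. -/
theorem near_const {α : Type*} {M : ℤ → Prop} (hM : ∃ m, M m) (g : ℤ → α)
    (hg : ∀ n, near M n = near M (n + 1) → g n = g (n + 1)) (n : ℤ) :
    g (near M n) = g n := by
  have key : ∀ d : ℕ, ∀ n, (near M n - n).natAbs = d → g (near M n) = g n := by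
    intro d
    induction d with
    | zero => intro n hn; rw [show near M n = n by omega]
    | succ d ih =>
      intro n hn
      have hs := near_spec hM n
      rcases lt_or_gt_of_ne (show near M n ≠ n by omega) with h | h
      · have h1 := near_eq (hs.step_left h)
        have h2 := ih (n - 1) (by omega)
        have h3 := hg (n - 1) (by rw [h1]; simp)
        rw [h1] at h2
        rw [h2, h3]; simp
      · have h1 := near_eq (hs.step_right h)
        have h2 := ih (n + 1) (by omega)
        have h3 := hg n h1.symm
        rw [h1] at h2
        rw [h2, h3]
  exact key _ n rfl

theorem int_rec_const {C : Type*} [AddCommGroup C] {f g : ℤ → C}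
    (h : ∀ n, f (n + 1) - f n = g (n + 1) - g n) (n : ℤ) : f n = g n + (f 0 - g 0) := by
  induction n with
  | zero => abel
  | succ n ih =>
    have := h n
    rw [ih] at this
    rw [← sub_eq_zero] at this ⊢
    rw [← this]; abel
  | pred n ih =>
    have := h (-n - 1)
    rw [show (-(n:ℤ) - 1 + 1) = -n by ring, ih] at this
    rw [← sub_eq_zero] at this ⊢
    rw [← neg_eq_zero, ← this]; abel

section T
variable {C : Type*} [CommRing C]

/-- `T s b` starts at `b 0` and has the jumps of `b` multiplied by `s`. -/
def twistSum (s b : ℤ → C) (n : ℤ) : C :=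
  b 0 + ∑ i ∈ Finset.range n.toNat, s (i + 1) * (b (i + 1) - b i)
    - ∑ i ∈ Finset.range (-n).toNat, s (-i) * (b (-i) - b (-i - 1))

theorem twistSum_zero (s b : ℤ → C) : twistSum s b 0 = b 0 := by simp [twistSum]

theorem twistSum_succ (s b : ℤ → C) (n : ℤ) :
    twistSum s b (n + 1) - twistSum s b n = s (n + 1) * (b (n + 1) - b n) := by
  unfold twistSum
  rcases le_or_gt 0 n with h | h
  · obtain ⟨m, rfl⟩ := Int.eq_ofNat_of_zero_le h
    have h1 : ((m : ℤ) + 1).toNat = m + 1 := by omega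
    have h2 : (-((m : ℤ) + 1)).toNat = 0 := by omega
    have h3 : (-(m : ℤ)).toNat = 0 := by omega
    have h4 : (m : ℤ).toNat = m := by omega
    simp only [h1, h2, h3, h4, Finset.sum_range_succ, Finset.sum_range_zero]
    ring
  · obtain ⟨m, hm⟩ := Int.eq_ofNat_of_zero_le (show 0 ≤ -(n + 1) by omega)
    obtain rfl : n = -m - 1 := by omega
    have h1 : (-(m : ℤ)).toNat = 0 := by omega
    have h2 : (-(-(m : ℤ))).toNat = m := by omega
    have h3 : (-(m : ℤ) - 1).toNat = 0 := by omega
    have h4 : (-(-(m : ℤ) - 1)).toNat = m + 1 := by omega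
    simp only [sub_add_cancel, h1, h2, h3, h4, Finset.sum_range_succ, Finset.sum_range_zero]
    ring

theorem twistSum_unique {s b w : ℤ → C} (h0 : w 0 = b 0)
    (h : ∀ n, w (n + 1) - w n = s (n + 1) * (b (n + 1) - b n)) : twistSum s b = w := by
  funext n
  have := int_rec_const (f := twistSum s b) (g := w)
    (fun n => by rw [twistSum_succ, h]) n
  rw [this, twistSum_zero, h0]; ring

theorem twistSum_invol {s : ℤ → C} (hs : ∀ n, s n * s n = 1) (b : ℤ → C) :
    twistSum s (twistSum s b) = b := by
  refine twistSum_unique (twistSum_zero s b).symm fun n => ?_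
  rw [twistSum_succ, ← mul_assoc, hs, one_mul]

theorem twistSum_mul (s b : ℤ → C) (e : C) (n : ℤ) :
    e * twistSum s b n = twistSum s (fun i => e * b i) n := by
  refine (congrFun (twistSum_unique (w := fun n => e * twistSum s b n) ?_ fun n => ?_) n).symm
  · simp [twistSum_zero]
  · have := twistSum_succ s b n
    linear_combination e * this

theorem twistSum_shift {s ε ε' : ℤ → C} (hs : ∀ m n, s (m + n) = s m * s n)
    (hε : ∀ n, ε' n = s n * ε n) (b : ℤ → C) (m : ℤ) (a : C) : ∃ κ, ∀ n,
    twistSum s (fun n => ε m * b (n - m) + a) n = ε' m * twistSum s b (n - m) + κ := by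
  refine ⟨_, fun n => int_rec_const (f := twistSum s (fun n => ε m * b (n - m) + a))
    (g := fun n => ε' m * twistSum s b (n - m)) (fun n => ?_) n⟩
  have h1 := twistSum_succ s b (n - m)
  rw [show n - m + 1 = n + 1 - m by ring] at h1
  have h2 := hs m (n + 1 - m)
  rw [show m + (n + 1 - m) = n + 1 by ring] at h2
  rw [twistSum_succ, ← mul_sub, h1, hε, h2]
  ring

end T

section Rot
variable {k : ℕ}

def rot (a : ZMod k) (w : ZMod k → Bool) : ZMod k → Bool := fun b => w (b - a)

theorem rot_rot (a b : ZMod k) (w) : rot a (rot b w) = rot (a + b) w := by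
  funext c; simp only [rot]; congr 1; ring

theorem rot_zero (w : ZMod k → Bool) : rot 0 w = w := by
  funext c; simp [rot]

theorem rot_mul_fix [NeZero k] {h : ZMod k} {w} (hw : rot h w = w) (r : ZMod k) : rot (r * h) w = w := by
  have key : ∀ n : ℕ, rot ((n : ZMod k) * h) w = w := by
    intro n
    induction n with
    | zero => simp [rot_zero]
    | succ n ih =>
      push_cast
      rw [add_mul, one_mul, ← rot_rot, hw, ih]
  simpa using key r.val

def Good (e : ZMod k) (w : ZMod k → Bool) : Prop := ∀ h, rot h w = w → e * h = 0

theorem rot_inj {a : ZMod k} {w w'} (h : rot a w = rot a w') : w = w' := by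
  have := congrArg (rot (-a)) h
  simpa [rot_rot, rot_zero] using this

theorem good_rot (e a : ZMod k) (w) : Good e (rot a w) ↔ Good e w := by
  have : ∀ h, rot h (rot a w) = rot a w ↔ rot h w = w := by
    intro h
    rw [rot_rot, add_comm, ← rot_rot]
    exact ⟨rot_inj, fun h => by rw [h]⟩
  simp only [Good, this]

theorem exists_gamma (e : ZMod k) (he : e * e = e) : ∃ γ : (ZMod k → Bool) → ZMod k,
    (∀ w, e * γ w = γ w) ∧ ∀ a w, Good e w → γ (rot a w) = γ w + e * a := by
  let S : Setoid (ZMod k → Bool) :=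
    { r := fun w w' => ∃ a, rot a w' = w
      iseqv :=
        { refl := fun w => ⟨0, rot_zero w⟩
          symm := by
            rintro w w' ⟨a, rfl⟩
            exact ⟨-a, by simp [rot_rot, rot_zero]⟩
          trans := by
            rintro w w' w'' ⟨a, rfl⟩ ⟨b, rfl⟩
            exact ⟨a + b, (rot_rot a b _).symm⟩ } }
  have hc : ∀ w, ∃ a, rot a (Quotient.out (Quotient.mk S w)) = w := fun w =>
    Setoid.symm (Quotient.mk_out (s := S) w)
  choose c hc using hc
  refine ⟨fun w => e * c w, fun w => by rw [← mul_assoc, he], fun a w hw => ?_⟩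
  have hq : Quotient.mk S (rot a w) = Quotient.mk S w := Quotient.sound ⟨a, rfl⟩
  have h1 := hc (rot a w)
  have h2 := hc w
  rw [hq] at h1
  set q := Quotient.out (Quotient.mk S w)
  have h3 : rot (c (rot a w) - a - c w) w = w := by
    have e1 : rot (c (rot a w) - a - c w) (rot (c w) q) = rot (-a) (rot (c (rot a w)) q) := by
      rw [rot_rot, rot_rot]; congr 1; ring
    rw [h2, h1, rot_rot, neg_add_cancel, rot_zero] at e1
    exact e1
  have := hw _ h3
  linear_combination this

end Rot

section Main
set_option linter.unusedSectionVars false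
variable {k : ℕ} {ι : Type} [Fintype ι]

/-- A sign character. -/
structure IsSgn (ε : ℤ → ZMod k) : Prop where
  sq : ∀ n, ε n * ε n = 1
  add : ∀ m n, ε (m + n) = ε m * ε n

def act (ε : ℤ → ZMod k) (a : ZMod k) (m : ℤ) (x : ℤ → ZMod k → Bool) : ℤ → ZMod k → Bool :=
  fun n => rot (ε n * a) (x (n - m))

def FreeE (ε : ℤ → ZMod k) (x : ℤ → ZMod k → Bool) : Prop :=
  ∀ a m, act ε a m x = x → a = 0 ∧ m = 0

/-- The fixed idempotents and equivariant selectors. -/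
structure Sel (e z : ι → ZMod k) (γ : ι → (ZMod k → Bool) → ZMod k) : Prop where
  idem : ∀ i, e i * e i = e i
  orth : ∀ i j, i ≠ j → e i * e j = 0
  sum : ∑ i, e i = 1
  zne : ∀ i, z i ≠ 0
  mult : ∀ i v, e i * v ≠ 0 → ∃ r, r * v = z i
  gmem : ∀ i w, e i * γ i w = γ i w
  gequiv : ∀ i a w, Good (e i) w → γ i (rot a w) = γ i w + e i * a

def RF (e : ι → ZMod k) (x : ℤ → ZMod k → Bool) : Prop := ∀ i, ∃ n, Good (e i) (x n)

noncomputable def nr (e : ι → ZMod k) (x : ℤ → ZMod k → Bool) (i : ι) (n : ℤ) : ℤ :=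
  near (fun j => Good (e i) (x j)) n

noncomputable def beta1 (e : ι → ZMod k) (γ : ι → (ZMod k → Bool) → ZMod k) (ε : ℤ → ZMod k)
    (x : ℤ → ZMod k → Bool) (i : ι) (n : ℤ) : ZMod k :=
  ε (nr e x i n) * γ i (x (nr e x i n))

noncomputable def beta (e : ι → ZMod k) (γ : ι → (ZMod k → Bool) → ZMod k) (ε : ℤ → ZMod k)
    (x : ℤ → ZMod k → Bool) (n : ℤ) : ZMod k := ∑ i, beta1 e γ ε x i n

noncomputable def FF (e : ι → ZMod k) (γ : ι → (ZMod k → Bool) → ZMod k) (s ε ε' : ℤ → ZMod k)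
    (x : ℤ → ZMod k → Bool) : ℤ → ZMod k → Bool :=
  fun n => rot (ε' n * twistSum s (beta e γ ε x) n - ε n * beta e γ ε x n) (x n)

variable {e z : ι → ZMod k} {γ : ι → (ZMod k → Bool) → ZMod k} {s ε ε' : ℤ → ZMod k}
  {x : ℤ → ZMod k → Bool}

theorem nr_rot (u : ℤ → ZMod k) (i : ι) (n : ℤ) :
    nr e (fun n => rot (u n) (x n)) i n = nr e x i n := by
  simp only [nr, good_rot]

theorem RF.rot (h : RF e x) (u : ℤ → ZMod k) : RF e (fun n => rot (u n) (x n)) := by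
  intro i
  obtain ⟨n, hn⟩ := h i
  exact ⟨n, (good_rot _ _ _).2 hn⟩

theorem RF.shift (h : RF e x) (m : ℤ) : RF e (fun n => x (n - m)) := by
  intro i
  obtain ⟨n, hn⟩ := h i
  exact ⟨n + m, by simpa using hn⟩

theorem RF.act (h : RF e x) (ε) (a m) : RF e (act ε a m x) := (h.shift m).rot fun n => ε n * a

theorem RF.FF (h : RF e x) : RF e (FF e γ s ε ε' x) := h.rot _

theorem nr_good (h : RF e x) (i n) : Good (e i) (x (nr e x i n)) := (near_spec (h i) n).1

theorem nr_shift (h : RF e x) (m : ℤ) (i n) :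
    nr e (fun n => x (n - m)) i n = nr e x i (n - m) + m := by
  have := (near_spec (h i) (n - m)).shift (t := m)
  rw [sub_add_cancel] at this
  exact near_eq this

theorem e_mul_beta (H : Sel e z γ) (i n) : e i * beta e γ ε x n = beta1 e γ ε x i n := by
  rw [beta, Finset.mul_sum, Finset.sum_eq_single i]
  · rw [beta1, mul_left_comm, H.gmem]
  · intro j _ hj
    rw [beta1, mul_left_comm, ← H.gmem, ← mul_assoc (e i), H.orth i j hj.symm]; ring
  · simp

theorem beta_act (H : Sel e z γ) (hε : IsSgn ε) (h : RF e x) (a m n) :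
    beta e γ ε (act ε a m x) n = ε m * beta e γ ε x (n - m) + a := by
  have ha : a = ∑ i, e i * a := by rw [← Finset.sum_mul, H.sum, one_mul]
  rw [ha, beta, beta, Finset.mul_sum, ← Finset.sum_add_distrib]
  refine Finset.sum_congr rfl fun i _ => ?_
  rw [← ha]
  have h1 : nr e (act ε a m x) i n = nr e x i (n - m) + m := by
    unfold act
    rw [nr_rot (x := fun n => x (n - m)), nr_shift h]
  rw [beta1, h1, act, add_sub_cancel_right, H.gequiv _ _ _ (nr_good h _ _), hε.add, beta1]
  have q1 := hε.sq (nr e x i (n - m))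
  have q2 := hε.sq m
  generalize ε (nr e x i (n - m)) = A at *
  linear_combination (e i * a * ε m * ε m) * q1 + e i * a * q2

theorem beta_FF (H : Sel e z γ) (hs : IsSgn s) (hε : IsSgn ε) (hε' : IsSgn ε')
    (hεε : ∀ n, ε' n = s n * ε n) (h : RF e x) :
    beta e γ ε' (FF e γ s ε ε' x) = twistSum s (beta e γ ε x) := by
  funext n
  have h0 : ∀ t, t = ∑ i, e i * t := fun t => by rw [← Finset.sum_mul, H.sum, one_mul]
  rw [h0 (twistSum s (beta e γ ε x) n), beta]
  refine Finset.sum_congr rfl fun i _ => ?_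
  have hnr : nr e (FF e γ s ε ε' x) i n = nr e x i n := nr_rot _ i n
  rw [beta1, hnr, FF]
  set m := nr e x i n with hm
  rw [H.gequiv _ _ _ (nr_good h _ _)]
  have h1 : nr e x i m = m := near_eq (IsNear.self (nr_good h i n))
  have h2 : e i * beta e γ ε x m = ε m * γ i (x m) := by
    rw [e_mul_beta H, beta1, h1]
  have h3 : e i * twistSum s (beta e γ ε x) m = e i * twistSum s (beta e γ ε x) n := by
    simp only [twistSum_mul, e_mul_beta H]
    refine near_const (h i) (fun n => twistSum s (fun j => beta1 e γ ε x i j) n) ?_ n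
    intro j hj
    have h4 := twistSum_succ s (fun j => beta1 e γ ε x i j) j
    have h5 : beta1 e γ ε x i j = beta1 e γ ε x i (j + 1) := by
      unfold beta1 nr
      rw [hj]
    simp only [h5, sub_self, mul_zero] at h4
    exact (sub_eq_zero.1 h4).symm
  rw [← h3]
  have q1 := hε.sq m
  have q2 := hε'.sq m
  linear_combination (e i * twistSum s (beta e γ ε x) m) * q2 - (ε' m * ε m) * h2
    - ε' m * γ i (x m) * q1

theorem FF_FF (H : Sel e z γ) (hs : IsSgn s) (hε : IsSgn ε) (hε' : IsSgn ε')
    (hεε : ∀ n, ε' n = s n * ε n) (h : RF e x) :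
    FF e γ s ε' ε (FF e γ s ε ε' x) = x := by
  funext n
  rw [FF, beta_FF H hs hε hε' hεε h, twistSum_invol hs.sq, FF, rot_rot]
  convert rot_zero (x n) using 2
  ring

theorem FF_act (H : Sel e z γ) (hs : IsSgn s) (hε : IsSgn ε) (hε' : IsSgn ε')
    (hεε : ∀ n, ε' n = s n * ε n) (h : RF e x) (a m) :
    ∃ a', FF e γ s ε ε' (act ε a m x) = act ε' a' m (FF e γ s ε ε' x) := by
  obtain ⟨κ, hκ⟩ := twistSum_shift hs.add hεε (beta e γ ε x) m a
  refine ⟨κ, ?_⟩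
  funext n
  have hb : beta e γ ε (act ε a m x) = fun n => ε m * beta e γ ε x (n - m) + a :=
    funext fun n => beta_act H hε h a m n
  rw [FF, hb, hκ, act, act, rot_rot, FF, rot_rot]
  congr 1
  have g1 := hε.add (n - m) m
  have g2 := hε'.add (n - m) m
  rw [sub_add_cancel] at g1 g2
  have q1 := hε.sq m
  have q2 := hε'.sq m
  rw [g1, g2]
  linear_combination (ε' (n - m) * twistSum s (beta e γ ε x) (n - m)) * q2
    - (ε (n - m) * beta e γ ε x (n - m)) * q1

theorem FreeE.rf [NeZero k] (H : Sel e z γ) (hx : FreeE ε x) : RF e x := by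
  intro i
  by_contra hcon
  push Not at hcon
  refine H.zne i (hx (z i) 0 ?_).1
  funext n
  have := hcon n
  unfold Good at this
  push Not at this
  obtain ⟨h, h1, h2⟩ := this
  obtain ⟨r, hr⟩ := H.mult i h h2
  rw [act, sub_zero, ← hr, ← mul_assoc]
  exact rot_mul_fix h1 _

theorem FreeE.FF [NeZero k] (H : Sel e z γ) (hs : IsSgn s) (hε : IsSgn ε) (hε' : IsSgn ε')
    (hεε : ∀ n, ε' n = s n * ε n) (hεε' : ∀ n, ε n = s n * ε' n) (hx : FreeE ε x) :
    FreeE ε' (FF e γ s ε ε' x) := by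
  intro a m ham
  have h := hx.rf H
  have h' : RF e (_root_.FF e γ s ε ε' x) := h.FF
  obtain ⟨a', ha'⟩ := FF_act H hs hε' hε hεε' h' a m
  rw [ham, FF_FF H hs hε hε' hεε h] at ha'
  obtain ⟨-, rfl⟩ := hx _ _ ha'.symm
  refine ⟨?_, rfl⟩
  have h0 : a = ∑ i, e i * a := by rw [← Finset.sum_mul, H.sum, one_mul]
  rw [h0]
  refine Finset.sum_eq_zero fun i _ => ?_
  obtain ⟨n, hn⟩ := h' i
  have h1 := congrFun ham n
  rw [act, sub_zero] at h1
  have h2 := hn _ h1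
  have q := hε'.sq n
  linear_combination ε' n * h2 - e i * a * q

theorem FF_orbit (H : Sel e z γ) (hs : IsSgn s) (hε : IsSgn ε) (hε' : IsSgn ε')
    (hεε : ∀ n, ε' n = s n * ε n) (hεε' : ∀ n, ε n = s n * ε' n) {y : ℤ → ZMod k → Bool}
    (hx : RF e x) (hy : RF e y) :
    (∃ a m, act ε a m x = y) ↔
      ∃ a m, act ε' a m (FF e γ s ε ε' x) = FF e γ s ε ε' y := by
  constructor
  · rintro ⟨a, m, rfl⟩
    obtain ⟨a', ha'⟩ := FF_act H hs hε hε' hεε hx a m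
    exact ⟨a', m, ha'.symm⟩
  · rintro ⟨a, m, h⟩
    obtain ⟨a', ha'⟩ := FF_act H hs hε' hε hεε' (hx.FF (γ := γ) (s := s) (ε := ε) (ε' := ε')) a m
    rw [h, FF_FF H hs hε hε' hεε hx, FF_FF H hs hε hε' hεε hy] at ha'
    exact ⟨a', m, ha'.symm⟩

theorem measurable_nr [NeZero k] (i : ι) (n : ℤ) :
    Measurable fun x : {x : ℤ → ZMod k → Bool // RF e x} => nr e x.1 i n := by
  refine measurable_to_countable' fun m => ?_
  have hG : ∀ j, MeasurableSet {x : {x : ℤ → ZMod k → Bool // RF e x} | Good (e i) (x.1 j)} := by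
    intro j
    have : Measurable fun x : {x : ℤ → ZMod k → Bool // RF e x} => x.1 j :=
      (measurable_pi_apply j).comp measurable_subtype_coe
    exact this (Set.toFinite {w | Good (e i) w}).measurableSet
  have : (fun x : {x : ℤ → ZMod k → Bool // RF e x} => nr e x.1 i n) ⁻¹' {m} =
      {x | Good (e i) (x.1 m)} ∩
        ⋂ l : ℤ, ({x | Good (e i) (x.1 l)}ᶜ ∪ {x | nkey (m - n) ≤ nkey (l - n)}) := by
    ext x
    have h1 : nr e x.1 i n = m ↔ IsNear (fun j => Good (e i) (x.1 j)) n m :=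
      ⟨fun h => h ▸ near_spec (x.2 i) n, near_eq⟩
    simp only [Set.mem_preimage, Set.mem_singleton_iff, h1, IsNear, Set.mem_inter_iff,
      Set.mem_iInter, Set.mem_union, Set.mem_compl_iff, Set.mem_ofPred_eq, imp_iff_not_or]
  rw [this]
  exact (hG m).inter (MeasurableSet.iInter fun l => (hG l).compl.union (MeasurableSet.const _))

theorem measurable_FF [NeZero k] :
    Measurable fun x : {x : ℤ → ZMod k → Bool // RF e x} => FF e γ s ε ε' x.1 := by
  let _ : MeasurableSpace (ZMod k) := ⊤
  have : DiscreteMeasurableSpace (ZMod k) := ⟨fun _ => trivial⟩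
  have hev : ∀ {Y : Type} [MeasurableSpace Y] [Countable Y] [MeasurableSingletonClass Y]
      {B : Type} [MeasurableSpace B] (u : {x : ℤ → ZMod k → Bool // RF e x} → Y)
      (_ : Measurable u) (g : Y → {x : ℤ → ZMod k → Bool // RF e x} → B)
      (_ : ∀ y, Measurable (g y)), Measurable fun x => g (u x) x := by
    intro Y _ _ _ B _ u hu g hg
    have := measurable_from_prod_countable_right (f := fun p : Y × {x : ℤ → ZMod k → Bool // RF e x} => g p.1 p.2) hg
    exact this.comp (hu.prodMk measurable_id)
  have hb1 : ∀ i n, Measurable fun x : {x : ℤ → ZMod k → Bool // RF e x} => beta1 e γ ε x.1 i n := by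
    intro i n
    refine hev _ (measurable_nr i n) (fun m x => ε m * γ i (x.1 m)) fun m => ?_
    have : Measurable fun x : {x : ℤ → ZMod k → Bool // RF e x} => x.1 m :=
      (measurable_pi_apply m).comp measurable_subtype_coe
    exact (measurable_of_countable fun w => ε m * γ i w).comp this
  have hb : ∀ n, Measurable fun x : {x : ℤ → ZMod k → Bool // RF e x} => beta e γ ε x.1 n := by
    intro n
    unfold beta
    exact Finset.measurable_fun_sum _ fun i _ => hb1 i n
  have hT : ∀ n, Measurable fun x : {x : ℤ → ZMod k → Bool // RF e x} =>
      twistSum s (beta e γ ε x.1) n := by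
    intro n
    unfold twistSum
    fun_prop
  refine measurable_pi_iff.2 fun n => measurable_pi_iff.2 fun b => ?_
  have hu : Measurable fun x : {x : ℤ → ZMod k → Bool // RF e x} =>
      ε' n * twistSum s (beta e γ ε x.1) n - ε n * beta e γ ε x.1 n :=
    ((hT n).const_mul _).sub ((hb n).const_mul _)
  exact hev _ hu (fun a x => x.1 n (b - a)) fun a =>
    (measurable_pi_apply (b - a)).comp ((measurable_pi_apply n).comp measurable_subtype_coe)

end Main
end Core

section Final
variable {k : ℕ}

/-- The sign `(-1)^n` in `ℤ/kℤ`. -/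
def sgn (k : ℕ) (n : ℤ) : ZMod k := (((-1 : ℤˣ) ^ n : ℤˣ) : ℤ)

theorem isSgn_sgn : IsSgn (sgn k) where
  sq n := by
    have : (((-1 : ℤˣ) ^ n : ℤˣ) : ℤ) * (((-1 : ℤˣ) ^ n : ℤˣ) : ℤ) = 1 := by
      rw [← Units.val_mul, Int.units_mul_self, Units.val_one]
    unfold sgn
    rw [← Int.cast_mul, this, Int.cast_one]
  add m n := by
    unfold sgn
    rw [zpow_add, Units.val_mul, Int.cast_mul]

theorem isSgn_one : IsSgn (fun _ : ℤ => (1 : ZMod k)) where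
  sq _ := by simp
  add _ _ := by simp

theorem phiK_apply (n : ℤ) (b : ZMod k) :
    phiK k (ofAdd n) (ofAdd b) = ofAdd (sgn k n * b) := by
  have hsq : (MulEquiv.inv (Multiplicative (ZMod k)) : MulAut (Multiplicative (ZMod k))) ^ (2 : ℤ) = 1 := by
    rw [zpow_ofNat, pow_two]
    ext x
    simp
  have h0 : phiK k (ofAdd n) = (MulEquiv.inv (Multiplicative (ZMod k)) : MulAut _) ^ n := by
    simp [phiK, zpowersHom_apply]
  rw [h0]
  rcases Int.even_or_odd' n with ⟨c, rfl | rfl⟩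
  · rw [zpow_mul, hsq, one_zpow]
    simp [sgn, zpow_mul]
  · rw [zpow_add, zpow_mul, hsq, one_zpow, one_mul, zpow_one]
    simp [sgn, zpow_add, zpow_mul]

/-- Coordinates on `2^{Γ_k}`. -/
def toG : (GammaK k → Bool) ≃ (ℤ → ZMod k → Bool) where
  toFun x := fun n b => x (ofAdd (b, n))
  invFun y := fun g => y (toAdd g).2 (toAdd g).1
  left_inv _ := rfl
  right_inv _ := rfl

/-- Untwisted coordinates on `2^{Δ_k}`. -/
def toD : (DeltaK k → Bool) ≃ (ℤ → ZMod k → Bool) where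
  toFun x := fun n b => x ⟨ofAdd (sgn k n * b), ofAdd n⟩
  invFun y := fun g => y (toAdd g.right) (sgn k (toAdd g.right) * toAdd g.left)
  left_inv x := by
    funext g
    simp only [← mul_assoc, isSgn_sgn.sq, one_mul]
    rfl
  right_inv y := by
    funext n b
    simp [← mul_assoc, isSgn_sgn.sq]

theorem toG_shift (a : ZMod k) (m : ℤ) (x : GammaK k → Bool) :
    toG (shiftMap (ofAdd (a, m)) x) = act (fun _ => 1) a m (toG x) := by
  funext n b
  change x (ofAdd (-(a, m) + (b, n))) = x (ofAdd (b - 1 * a, n - m))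
  congr 2
  ext
  · simp [sub_eq_neg_add]
  · simp [sub_eq_neg_add]

theorem toD_shift (a : ZMod k) (m : ℤ) (x : DeltaK k → Bool) :
    toD (shiftMap ⟨ofAdd a, ofAdd m⟩ x) = act (sgn k) a m (toD x) := by
  funext n b
  simp only [toD, Equiv.coe_fn_mk, shiftMap, act, rot]
  congr 1
  have hm : sgn k (-m) = sgn k m := by
    have h1 := isSgn_sgn.add (k := k) (-m) m
    have h2 := isSgn_sgn.sq (k := k) m
    have h3 : sgn k 0 = 1 := by simp [sgn]
    rw [neg_add_cancel, h3] at h1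
    linear_combination -(sgn k m) * h1 - sgn k (-m) * h2
  have hn : sgn k (n - m) = sgn k n * sgn k m := by
    rw [sub_eq_add_neg, isSgn_sgn.add, hm]
  ext
  · rw [SemidirectProduct.mul_left, SemidirectProduct.inv_left, SemidirectProduct.inv_right]
    change phiK k (ofAdd (-m)) (ofAdd (-a)) * phiK k (ofAdd (-m)) (ofAdd (sgn k n * b)) =
      ofAdd (sgn k (n - m) * (b - sgn k n * a))
    rw [phiK_apply, phiK_apply, ← ofAdd_add, hm, hn]
    refine congrArg (fun t : ZMod k => ofAdd t) ?_
    have h2 := isSgn_sgn.sq (k := k) n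
    linear_combination a * sgn k m * h2
  · rw [SemidirectProduct.mul_right, SemidirectProduct.inv_right]
    simp only [← ofAdd_neg, ← ofAdd_add]
    apply congrArg ofAdd
    ring

theorem mem_freeG (x : GammaK k → Bool) : x ∈ FreePart (GammaK k) ↔ FreeE (fun _ => 1) (toG x) := by
  constructor
  · intro h a m ham
    rw [← toG_shift, toG.apply_eq_iff_eq] at ham
    by_contra hne
    refine h (ofAdd (a, m)) (fun h1 => hne ?_) ham
    have h2 : (a, m) = (0 : ZMod k × ℤ) := h1
    exact Prod.ext_iff.1 h2
  · intro h g hg hx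
    have h1 := h (toAdd g).1 (toAdd g).2 (by rw [← toG_shift]; exact congrArg toG hx)
    exact hg (congrArg ofAdd (Prod.ext h1.1 h1.2 : toAdd g = (0 : ZMod k × ℤ)))

theorem mem_freeD (x : DeltaK k → Bool) : x ∈ FreePart (DeltaK k) ↔ FreeE (sgn k) (toD x) := by
  constructor
  · intro h a m ham
    rw [← toD_shift, toD.apply_eq_iff_eq] at ham
    by_contra hne
    refine h ⟨ofAdd a, ofAdd m⟩ (fun h1 => hne ?_) ham
    exact ⟨congrArg (fun g : DeltaK k => toAdd g.left) h1,
      congrArg (fun g : DeltaK k => toAdd g.right) h1⟩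
  · intro h g hg hx
    have h1 := h (toAdd g.left) (toAdd g.right) (by rw [← toD_shift]; exact congrArg toD hx)
    exact hg (SemidirectProduct.ext (congrArg ofAdd h1.1) (congrArg ofAdd h1.2))

end Final

/-- For `k ≥ 3` there is a Borel bijection
`f : F(2^{Γ_k}) → F(2^{Δ_k})` such that `x, y` lie in the same `Γ_k`-orbit iff
`f x, f y` lie in the same `Δ_k`-orbit; i.e. the orbit equivalence relations of the two
shift actions are Borel isomorphic. -/
theorem orbit_equivalence_relations_borel_isomorphic (k : ℕ) (hk : 3 ≤ k) :
    ∃ f : FreePart (GammaK k) ≃ FreePart (DeltaK k),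
      Measurable (⇑f) ∧
      ∀ x y : FreePart (GammaK k),
        (∃ g : GammaK k, shiftMap g (x : GammaK k → Bool) = (y : GammaK k → Bool)) ↔
        (∃ d : DeltaK k,
          shiftMap d (f x : DeltaK k → Bool) = (f y : DeltaK k → Bool)) := by
  have : NeZero k := ⟨by omega⟩
  obtain ⟨ι, _, e, z, h1, h2, h3, h4, h5⟩ := zk_idem k (by omega)
  choose γ hγ1 hγ2 using fun i => exists_gamma (e i) (h1 i)
  have H : Sel e z γ := ⟨h1, h2, h3, h4, h5, hγ1, hγ2⟩
  have hs := isSgn_sgn (k := k)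
  have ho := isSgn_one (k := k)
  have e1 : ∀ n, sgn k n = sgn k n * (fun _ => 1 : ℤ → ZMod k) n := fun n => by simp
  have e2 : ∀ n, (fun _ => 1 : ℤ → ZMod k) n = sgn k n * sgn k n := fun n => (hs.sq n).symm
  have hG : ∀ x : FreePart (GammaK k), FreeE (fun _ => 1) (toG x.1) := fun x => (mem_freeG _).1 x.2
  have hD : ∀ x : FreePart (DeltaK k), FreeE (sgn k) (toD x.1) := fun x => (mem_freeD _).1 x.2
  let f : FreePart (GammaK k) ≃ FreePart (DeltaK k) :=
    { toFun := fun x => ⟨toD.symm (FF e γ (sgn k) (fun _ => 1) (sgn k) (toG x.1)), by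
        rw [mem_freeD, Equiv.apply_symm_apply]
        exact (hG x).FF H hs ho hs e1 e2⟩
      invFun := fun y => ⟨toG.symm (FF e γ (sgn k) (sgn k) (fun _ => 1) (toD y.1)), by
        rw [mem_freeG, Equiv.apply_symm_apply]
        exact (hD y).FF H hs hs ho e2 e1⟩
      left_inv := fun x => by
        apply Subtype.ext
        simp only [Equiv.apply_symm_apply]
        rw [FF_FF H hs ho hs e1 ((hG x).rf H), Equiv.symm_apply_apply]
      right_inv := fun x => by
        apply Subtype.ext
        simp only [Equiv.apply_symm_apply]
        rw [FF_FF H hs hs ho e2 ((hD x).rf H), Equiv.symm_apply_apply] }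
  have hf : ∀ x, toD (f x).1 = FF e γ (sgn k) (fun _ => 1) (sgn k) (toG x.1) :=
    fun x => Equiv.apply_symm_apply _ _
  refine ⟨f, ?_, fun x y => ?_⟩
  · refine Measurable.subtype_mk ?_
    have m1 : Measurable fun x : FreePart (GammaK k) =>
        (⟨toG x.1, (hG x).rf H⟩ : {x : ℤ → ZMod k → Bool // RF e x}) := by
      refine Measurable.subtype_mk ?_
      refine measurable_pi_iff.2 fun n => measurable_pi_iff.2 fun b => ?_
      exact (measurable_pi_apply (ofAdd (b, n) : GammaK k)).comp measurable_subtype_coe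
    have m2 := (measurable_FF (e := e) (γ := γ) (s := sgn k) (ε := fun _ => 1) (ε' := sgn k)).comp m1
    refine measurable_pi_iff.2 fun g => ?_
    exact (measurable_pi_apply (sgn k (toAdd g.right) * toAdd g.left)).comp
      ((measurable_pi_apply (toAdd g.right)).comp m2)
  · have key := FF_orbit H hs ho hs e1 e2 ((hG x).rf H) ((hG y).rf H)
    rw [← hf, ← hf] at key
    have k1 : (∃ g : GammaK k, shiftMap g (x : GammaK k → Bool) = (y : GammaK k → Bool)) ↔
        ∃ a m, act (fun _ => 1) a m (toG x.1) = toG y.1 := by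
      constructor
      · rintro ⟨g, hg⟩
        exact ⟨(toAdd g).1, (toAdd g).2, by rw [← toG_shift]; exact congrArg toG hg⟩
      · rintro ⟨a, m, h⟩
        rw [← toG_shift, toG.apply_eq_iff_eq] at h
        exact ⟨_, h⟩
    have k2 : (∃ d : DeltaK k, shiftMap d (f x : DeltaK k → Bool) = (f y : DeltaK k → Bool)) ↔
        ∃ a m, act (sgn k) a m (toD (f x).1) = toD (f y).1 := by
      constructor
      · rintro ⟨g, hg⟩
        exact ⟨toAdd g.left, toAdd g.right, by rw [← toD_shift]; exact congrArg toD hg⟩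
      · rintro ⟨a, m, h⟩
        rw [← toD_shift, toD.apply_eq_iff_eq] at h
        exact ⟨_, h⟩
    rw [k1, k2, key]
end
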